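/- arXiv:1911.09866 — 4 statements merged into one kernel-verified Lean document; each statement's English description precedes it below -/
import Mathlib

section
/- Let 3 ≤ k ≤ n−1 and let T be an n-vertex chemical tree with exactly k segments such that M2(T') ≤ M2(T) for every n-vertex chemical tree T' with exactly k segments. Then every vertex of degree 3 in T has at most one branching neighbor. -/
open SimpleGraph

namespace ChemTree

variable {V : Type*}

/-- The degree of a vertex. -/
noncomputable def deg (G : SimpleGraph V) (v : V) : ℕ :=
  (G.neighborSet v).ncard

/-- A chemical tree: a tree in which every vertex has degree at most 4. -/
def IsChemicalTree (G : SimpleGraph V) : Prop :=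
  G.IsTree ∧ ∀ v, deg G v ≤ 4

/-- `nDeg G i` is the number of vertices of `G` having degree `i`. -/
noncomputable def nDeg (G : SimpleGraph V) (i : ℕ) : ℕ :=
  {v | deg G v = i}.ncard

/-- The first Zagreb index. -/
noncomputable def M1 (G : SimpleGraph V) [Fintype V] : ℕ :=
  ∑ v, (deg G v) ^ 2

/-- The second Zagreb index. -/
noncomputable def M2 (G : SimpleGraph V) [Fintype V] : ℕ :=
  ∑ e ∈ (Set.toFinite G.edgeSet).toFinset,
    Sym2.lift ⟨fun u w => deg G u * deg G w, fun u w => Nat.mul_comm _ _⟩ e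

/-- A segment: a nontrivial path whose end vertices have degree `≠ 2` and whose
internal vertices all have degree `2`. -/
def IsSegment (G : SimpleGraph V) {u v : V} (p : G.Walk u v) : Prop :=
  p.IsPath ∧ 0 < p.length ∧ deg G u ≠ 2 ∧ deg G v ≠ 2 ∧
    ∀ w ∈ p.support, w ≠ u → w ≠ v → deg G w = 2

/-- The number of segments: in a tree, a segment is uniquely determined by the
unordered pair of its end vertices. -/
noncomputable def numSegments (G : SimpleGraph V) : ℕ :=
  {s : Sym2 V | ∃ (u v : V) (p : G.Walk u v), s = s(u, v) ∧ IsSegment G p}.ncard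

/-- The number of branching vertices (vertices of degree at least 3). -/
noncomputable def numBranching (G : SimpleGraph V) : ℕ :=
  {v | 3 ≤ deg G v}.ncard

/-- An internal path: both end vertices are branching and all internal vertices
have degree `2`. -/
def IsInternalPath (G : SimpleGraph V) {u v : V} (p : G.Walk u v) : Prop :=
  p.IsPath ∧ 0 < p.length ∧ 3 ≤ deg G u ∧ 3 ≤ deg G v ∧
    ∀ w ∈ p.support, w ≠ u → w ≠ v → deg G w = 2

/-- A pendent path: one end vertex is pendent, the other is branching and all
internal vertices have degree `2`. -/
def IsPendentPath (G : SimpleGraph V) {u v : V} (p : G.Walk u v) : Prop :=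
  p.IsPath ∧ 0 < p.length ∧ deg G u = 1 ∧ 3 ≤ deg G v ∧
    ∀ w ∈ p.support, w ≠ u → w ≠ v → deg G w = 2

end ChemTree

open ChemTree

namespace ChemTree

open Finset

/-- The graph joining every vertex other than the root `r` to its parent under `f`. -/
def parentGraph {V : Type*} (r : V) (f : V → V) : SimpleGraph V :=
  SimpleGraph.fromRel fun x y => x ≠ r ∧ f x = y

open Classical in
/-- The vertices whose parent is `w`. -/
noncomputable def children {V : Type*} [Fintype V] (r : V) (f : V → V) (w : V) : Finset V :=
  {x | x ≠ r ∧ f x = w}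

open Classical in
/-- The degree of `w` in the tree with root `r` and parent map `f`. -/
noncomputable def parentDeg {V : Type*} [Fintype V] (r : V) (f : V → V) (w : V) : ℕ :=
  #(children r f w) + if w = r then 0 else 1

section ParentMap

variable {V : Type*} {r : V} {f : V → V} {h : V → ℕ}

lemma parentGraph_adj (hh : ∀ w, w ≠ r → h (f w) < h w) {x y : V} :
    (parentGraph r f).Adj x y ↔ (x ≠ r ∧ f x = y) ∨ (y ≠ r ∧ f y = x) := by
  simp only [parentGraph, SimpleGraph.fromRel_adj, and_iff_right_iff_imp]
  rintro (⟨hx, rfl⟩ | ⟨hx, rfl⟩) he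
  · have := hh x hx
    rw [← he] at this
    omega
  · have := hh y hx
    rw [he] at this
    omega

lemma injOn_parent_edge (hh : ∀ w, w ≠ r → h (f w) < h w) :
    Set.InjOn (fun w => s(w, f w)) {w | w ≠ r} := by
  intro x hx y hy hxy
  rcases Sym2.eq_iff.1 hxy with ⟨h1, -⟩ | ⟨h1, h2⟩
  · exact h1
  · have h3 := hh x hx
    have h4 := hh y hy
    rw [← h1] at h4
    rw [h2] at h3
    omega

lemma image_parent_edge (hh : ∀ w, w ≠ r → h (f w) < h w) :
    (fun w => s(w, f w)) '' {w | w ≠ r} = (parentGraph r f).edgeSet := by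
  ext e
  induction e with | _ x y
  simp only [Set.mem_image, Set.mem_ofPred_eq, SimpleGraph.mem_edgeSet, parentGraph_adj hh]
  constructor
  · rintro ⟨w, hw, he⟩
    rcases Sym2.eq_iff.1 he with ⟨rfl, rfl⟩ | ⟨rfl, rfl⟩
    · exact Or.inl ⟨hw, rfl⟩
    · exact Or.inr ⟨hw, rfl⟩
  · rintro (⟨hx, rfl⟩ | ⟨hy, rfl⟩)
    · exact ⟨x, hx, rfl⟩
    · exact ⟨y, hy, Sym2.eq_swap⟩

lemma exists_iterate_eq_root (hh : ∀ w, w ≠ r → h (f w) < h w) (w : V) :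
    ∃ k, f^[k] w = r := by
  induction hn : h w using Nat.strong_induction_on generalizing w with
  | _ n ih =>
    by_cases hw : w = r
    · exact ⟨0, hw⟩
    · obtain ⟨k, hk⟩ := ih (h (f w)) (hn ▸ hh w hw) (f w) rfl
      exact ⟨k + 1, hk⟩

lemma connected_parentGraph (hh : ∀ w, w ≠ r → h (f w) < h w) :
    (parentGraph r f).Connected := by
  have key : ∀ w, (parentGraph r f).Reachable w r := by
    intro w
    induction hn : h w using Nat.strong_induction_on generalizing w with
    | _ n ih =>
      by_cases hw : w = r
      · rw [hw]
      · have hadj : (parentGraph r f).Adj w (f w) := (parentGraph_adj hh).2 (Or.inl ⟨hw, rfl⟩)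
        exact hadj.reachable.trans (ih (h (f w)) (hn ▸ hh w hw) (f w) rfl)
  have : Nonempty V := ⟨r⟩
  exact ⟨fun x y => (key x).trans (key y).symm⟩

lemma card_edgeSet_parentGraph [Finite V] (hh : ∀ w, w ≠ r → h (f w) < h w) :
    Nat.card (parentGraph r f).edgeSet + 1 = Nat.card V := by
  have h1 : (parentGraph r f).edgeSet.ncard = {w | w ≠ r}.ncard := by
    rw [← image_parent_edge hh, (injOn_parent_edge hh).ncard_image]
  have h2 := Set.ncard_add_ncard_compl {r} (Set.toFinite _) (Set.toFinite _)
  rw [Set.ncard_singleton] at h2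
  have h3 : ({r}ᶜ : Set V) = {w | w ≠ r} := rfl
  rw [h3] at h2
  rw [Nat.card_coe_set_eq, h1]
  omega

lemma isTree_parentGraph [Finite V] (hh : ∀ w, w ≠ r → h (f w) < h w) :
    (parentGraph r f).IsTree :=
  SimpleGraph.isTree_iff_connected_and_card.2
    ⟨connected_parentGraph hh, card_edgeSet_parentGraph hh⟩

/-- Every finite tree arises from a parent map towards any chosen root. -/
lemma exists_parentGraph_eq [Finite V] {T : SimpleGraph V} (hT : T.IsTree) (r : V) :
    ∃ (f : V → V) (h : V → ℕ), f r = r ∧ (∀ w, w ≠ r → h (f w) < h w) ∧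
      parentGraph r f = T := by
  have key : ∀ w, ∃ p, (w = r → p = r) ∧ (w ≠ r → T.Adj w p ∧ T.dist p r < T.dist w r) := by
    intro w
    by_cases hw : w = r
    · exact ⟨r, fun _ => rfl, fun h => (h hw).elim⟩
    · obtain ⟨p, hp⟩ := hT.connected.exists_walk_length_eq_dist w r
      cases p with
      | nil => exact (hw rfl).elim
      | @cons _ m _ hadj q =>
        refine ⟨m, fun h => (hw h).elim, fun _ => ⟨hadj, ?_⟩⟩
        have := SimpleGraph.dist_le q
        rw [SimpleGraph.Walk.length_cons] at hp
        omega
  choose f hf1 hf2 using key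
  have hh : ∀ w, w ≠ r → T.dist (f w) r < T.dist w r := fun w hw => (hf2 w hw).2
  refine ⟨f, fun w => T.dist w r, hf1 r rfl, hh, ?_⟩
  have hle : parentGraph r f ≤ T := by
    intro x y hxy
    rcases (parentGraph_adj (h := fun w => T.dist w r) hh).1 hxy with ⟨hx, rfl⟩ | ⟨hy, rfl⟩
    · exact (hf2 x hx).1
    · exact (hf2 y hy).1.symm
  have h1 := card_edgeSet_parentGraph (h := fun w => T.dist w r) hh
  have h2 := (SimpleGraph.isTree_iff_connected_and_card.1 hT).2
  rw [Nat.card_coe_set_eq] at h1 h2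
  refine SimpleGraph.edgeSet_injective (Set.eq_of_subset_of_ncard_le
    (SimpleGraph.edgeSet_mono hle) (by omega) (Set.toFinite _))

variable [Fintype V]

lemma mem_children {w x : V} : x ∈ children r f w ↔ x ≠ r ∧ f x = w := by
  simp [children]

lemma parentDeg_root : parentDeg r f r = #(children r f r) := by simp [parentDeg]

lemma parentDeg_of_ne {w : V} (hw : w ≠ r) : parentDeg r f w = #(children r f w) + 1 := by
  simp [parentDeg, hw]

lemma deg_parentGraph (hh : ∀ w, w ≠ r → h (f w) < h w) (w : V) :
    deg (parentGraph r f) w = parentDeg r f w := by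
  classical
  unfold deg
  by_cases hw : w = r
  · subst hw
    rw [parentDeg_root, ← Set.ncard_coe_finset]
    congr 1
    ext x
    simp [mem_children, parentGraph_adj hh]
  · have hnot : f w ∉ children r f w := by
      intro hm
      obtain ⟨h1, h2⟩ := mem_children.1 hm
      have h3 := hh _ h1
      have h4 := hh _ hw
      rw [h2] at h3
      omega
    rw [parentDeg_of_ne hw, ← card_insert_of_notMem hnot, ← Set.ncard_coe_finset]
    congr 1
    ext x
    simp [mem_children, parentGraph_adj hh, hw, eq_comm]

open Classical in
lemma M2_parentGraph (hh : ∀ w, w ≠ r → h (f w) < h w) :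
    M2 (parentGraph r f) = ∑ w ∈ univ.erase r, parentDeg r f w * parentDeg r f (f w) := by
  unfold M2
  have hE : (Set.toFinite (parentGraph r f).edgeSet).toFinset =
      (univ.erase r).image fun w => s(w, f w) := by
    rw [← Finset.coe_inj, Set.Finite.coe_toFinset, ← image_parent_edge hh]
    simp [Set.ext_iff]
  rw [hE, sum_image]
  · simp [deg_parentGraph hh]
  · intro x hx y hy hxy
    exact injOn_parent_edge hh (by simpa using hx) (by simpa using hy) hxy

open Classical in
/-- Moving `x` below `y` raises the degree of `y` and lowers that of the old parent. -/
lemma parentDeg_update {x : V} (hx : x ≠ r) (y w : V) :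
    parentDeg r (Function.update f x y) w + (if w = f x then 1 else 0) =
      parentDeg r f w + if w = y then 1 else 0 := by
  have key : #(children r (Function.update f x y) w) + (if w = f x then 1 else 0) =
      #(children r f w) + if w = y then 1 else 0 := by
    have hc : ∀ g : V → V, #(children r g w) =
        (if w = g x then 1 else 0) + #((univ.erase x).filter fun z => z ≠ r ∧ g z = w) := by
      intro g
      unfold children
      rw [card_filter, card_filter, ← add_sum_erase _ _ (mem_univ x)]
      simp [hx, eq_comm]
    rw [hc f, hc (Function.update f x y)]
    have : ((univ.erase x).filter fun z => z ≠ r ∧ Function.update f x y z = w) =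
        (univ.erase x).filter fun z => z ≠ r ∧ f z = w := by
      refine filter_congr fun z hz => ?_
      rw [Function.update_of_ne (ne_of_mem_erase hz)]
    rw [this, Function.update_self]
    omega
  unfold parentDeg
  omega

end ParentMap

section Segments

variable {V : Type*} {r : V} {f : V → V} {h : V → ℕ}

lemma rank_iterate_le (hr : f r = r) (hh : ∀ w, w ≠ r → h (f w) < h w) (k : ℕ) (w : V) :
    h (f^[k] w) ≤ h w := by
  induction k generalizing w with
  | zero => rfl
  | succ k ih =>
    refine (ih (f w)).trans ?_
    by_cases hw : w = r
    · rw [hw, hr]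
    · exact (hh w hw).le

lemma rank_root_lt (hr : f r = r) (hh : ∀ w, w ≠ r → h (f w) < h w) {w : V} (hw : w ≠ r) :
    h r < h w := by
  obtain ⟨k, hk⟩ := exists_iterate_eq_root hh (f w)
  have hle := rank_iterate_le hr hh k (f w)
  rw [hk] at hle
  exact hle.trans_lt (hh w hw)

lemma iterate_ne_of_iterate_eq (hroot : f r = r) {a b : V} (hfa : f a = r) (hfb : f b = r)
    (har : a ≠ r) (hbr : b ≠ r) (hab : a ≠ b) {u : V} (hu : ∃ k, f^[k] u = a) (j : ℕ) :
    f^[j] u ≠ b := by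
  obtain ⟨i, hi⟩ := hu
  intro hj
  have aux : ∀ {i j : ℕ} {a b : V}, f a = r → b ≠ r → f^[i] u = a → f^[j] u = b → j ≤ i := by
    intro i j a b hfa hbr hi hj
    by_contra hlt
    obtain ⟨m, rfl⟩ : ∃ m, j = m + 1 + i := ⟨j - i - 1, by omega⟩
    rw [Function.iterate_add_apply, hi, Function.iterate_succ_apply, hfa,
      Function.iterate_fixed hroot] at hj
    exact hbr hj.symm
  have hij : i = j := le_antisymm (aux hfb har hj hi) (aux hfa hbr hi hj)
  exact hab (by rw [← hi, ← hj, hij])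

lemma exists_path_iterate (hr : f r = r) (hh : ∀ w, w ≠ r → h (f w) < h w) (k : ℕ) (x y : V)
    (hxy : f^[k] x = y) (hx : ∀ j < k, f^[j] x ≠ r) :
    ∃ p : (parentGraph r f).Walk x y, p.IsPath ∧ p.length = k ∧
      ∀ w ∈ p.support, ∃ j ≤ k, w = f^[j] x := by
  induction k generalizing x with
  | zero =>
    obtain rfl : x = y := hxy
    exact ⟨.nil, by simp, rfl, by simp⟩
  | succ k ih =>
    obtain ⟨p, hp, hl, hs⟩ := ih (f x) hxy fun j hj => hx (j + 1) (by omega)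
    have hx0 : x ≠ r := hx 0 (by omega)
    have hadj : (parentGraph r f).Adj x (f x) := (parentGraph_adj hh).2 (Or.inl ⟨hx0, rfl⟩)
    refine ⟨.cons hadj p, ?_, by simp [hl], ?_⟩
    · rw [SimpleGraph.Walk.cons_isPath_iff]
      refine ⟨hp, fun hm => ?_⟩
      obtain ⟨j, -, hj⟩ := hs x hm
      have h1 := rank_iterate_le hr hh j (f x)
      have h2 := hh x hx0
      rw [← hj] at h1
      omega
    · intro w hw
      rw [SimpleGraph.Walk.support_cons, List.mem_cons] at hw
      rcases hw with rfl | hw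
      · exact ⟨0, by omega, rfl⟩
      · obtain ⟨j, hj, rfl⟩ := hs w hw
        exact ⟨j + 1, by omega, rfl⟩

variable [Fintype V]

/-- `z` is the first vertex of degree different from `2` strictly above `w`. -/
def IsFirstAbove (r : V) (f : V → V) (w z : V) : Prop :=
  ∃ k, f^[k] (f w) = z ∧ parentDeg r f z ≠ 2 ∧ ∀ j < k, parentDeg r f (f^[j] (f w)) = 2

lemma IsFirstAbove.unique {w z z' : V} (hz : IsFirstAbove r f w z)
    (hz' : IsFirstAbove r f w z') : z = z' := by
  obtain ⟨k, rfl, h2, h3⟩ := hz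
  obtain ⟨k', rfl, h2', h3'⟩ := hz'
  rcases lt_trichotomy k k' with hlt | rfl | hlt
  · exact (h2 (h3' _ hlt)).elim
  · rfl
  · exact (h2' (h3 _ hlt)).elim

lemma exists_isFirstAbove (hh : ∀ w, w ≠ r → h (f w) < h w) (hr : parentDeg r f r ≠ 2) (w : V) :
    ∃ z, IsFirstAbove r f w z := by
  classical
  have hex : ∃ k, parentDeg r f (f^[k] (f w)) ≠ 2 := by
    obtain ⟨k, hk⟩ := exists_iterate_eq_root hh (f w)
    exact ⟨k, by rwa [hk]⟩
  exact ⟨_, Nat.find hex, rfl, Nat.find_spec hex, fun j hj => not_not.1 (Nat.find_min hex hj)⟩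

lemma child_unique_of_parentDeg_eq_two {x y z : V} (hx : x ≠ r) (h2 : parentDeg r f x = 2)
    (hy : y ≠ r ∧ f y = x) (hz : z ≠ r ∧ f z = x) : y = z := by
  rw [parentDeg_of_ne hx] at h2
  exact card_le_one.1 (by omega) y (mem_children.2 hy) z (mem_children.2 hz)

lemma iterate_of_path_from_child (hh : ∀ w, w ≠ r → h (f w) < h w)
    (hr : parentDeg r f r ≠ 2) {x y : V} (p : (parentGraph r f).Walk x y) (hp : p.IsPath)
    (hi : ∀ w ∈ p.support, w ≠ y → parentDeg r f w = 2) (z : V) (hz : z ≠ r) (hzx : f z = x)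
    (hzp : z ∉ p.support) :
    ∃ k, f^[k] x = y ∧ ∀ j < k, parentDeg r f (f^[j] x) = 2 := by
  induction p generalizing z with
  | nil => exact ⟨0, rfl, by simp⟩
  | @cons x m y hadj q ih =>
    rw [SimpleGraph.Walk.cons_isPath_iff] at hp
    rw [SimpleGraph.Walk.support_cons] at hi hzp
    have hxy : x ≠ y := fun he => hp.2 (he ▸ q.end_mem_support)
    have hx2 := hi x (by simp) hxy
    have hxr : x ≠ r := fun he => hr (he ▸ hx2)
    have hm : f x = m := by
      rcases (parentGraph_adj hh).1 hadj with ⟨-, hm⟩ | hm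
      · exact hm
      · have := child_unique_of_parentDeg_eq_two hxr hx2 hm ⟨hz, hzx⟩
        exact (hzp (by simp [← this])).elim
    obtain ⟨k, hk, hk2⟩ := ih hp.1 (fun w hw => hi w (by simp [hw])) x hxr hm hp.2
    refine ⟨k + 1, by rw [Function.iterate_succ_apply, hm, hk], fun j hj => ?_⟩
    cases j with
    | zero => exact hx2
    | succ j =>
      rw [Function.iterate_succ_apply, hm]
      exact hk2 j (by omega)

lemma iterate_of_path_from_parent (hh : ∀ w, w ≠ r → h (f w) < h w)
    {x y : V} (p : (parentGraph r f).Walk x y) (hp : p.IsPath)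
    (hi : ∀ w ∈ p.support, w ≠ y → parentDeg r f w = 2) (z : V) (hx : x ≠ r) (hzx : f x = z)
    (hzp : z ∉ p.support) :
    y ≠ r ∧ ∃ k, f^[k] (f y) = z ∧ ∀ j < k, parentDeg r f (f^[j] (f y)) = 2 := by
  induction p generalizing z with
  | nil => exact ⟨hx, 0, hzx, by simp⟩
  | @cons x m y hadj q ih =>
    rw [SimpleGraph.Walk.cons_isPath_iff] at hp
    rw [SimpleGraph.Walk.support_cons] at hi hzp
    have hxy : x ≠ y := fun he => hp.2 (he ▸ q.end_mem_support)
    have hx2 := hi x (by simp) hxy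
    have hm : m ≠ r ∧ f m = x := by
      rcases (parentGraph_adj hh).1 hadj with ⟨-, hm⟩ | hm
      · exact (hzp (by simp [← hzx, hm])).elim
      · exact hm
    obtain ⟨hy, k, hk, hk2⟩ := ih hp.1 (fun w hw => hi w (by simp [hw])) x hm.1 hm.2 hp.2
    refine ⟨hy, k + 1, by rw [Function.iterate_succ_apply', hk, hzx], fun j hj => ?_⟩
    rcases Nat.lt_succ_iff_lt_or_eq.1 hj with hj | rfl
    · exact hk2 j hj
    · rwa [hk]

/-- If the root does not have degree `2`, every segment is the one leading upwards from exactly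
one non-root vertex of degree different from `2`. -/
lemma numSegments_parentGraph (hroot : f r = r) (hh : ∀ w, w ≠ r → h (f w) < h w)
    (hr : parentDeg r f r ≠ 2) :
    numSegments (parentGraph r f) = {w | w ≠ r ∧ parentDeg r f w ≠ 2}.ncard := by
  choose g hg using exists_isFirstAbove hh hr
  have hrank : ∀ w, w ≠ r → h (g w) < h w := by
    intro w hw
    obtain ⟨k, hk, -⟩ := hg w
    rw [← hk]
    exact (rank_iterate_le hroot hh k (f w)).trans_lt (hh w hw)
  have himage : (fun w => s(w, g w)) '' {w | w ≠ r ∧ parentDeg r f w ≠ 2} =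
      {s : Sym2 V | ∃ (u v : V) (p : (parentGraph r f).Walk u v),
        s = s(u, v) ∧ IsSegment (parentGraph r f) p} := by
    ext s
    simp only [Set.mem_image, Set.mem_ofPred_eq, IsSegment, deg_parentGraph hh]
    constructor
    · rintro ⟨w, ⟨hw, hw2⟩, rfl⟩
      obtain ⟨k, hk, hk2, hkj⟩ := hg w
      have hne : ∀ j < k + 1, f^[j] w ≠ r := by
        intro j hj he
        cases j with
        | zero => exact hw he
        | succ j => exact hr (he ▸ hkj j (by omega))
      obtain ⟨p, hp, hl, hs⟩ := exists_path_iterate hroot hh (k + 1) w (g w) hk hne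
      refine ⟨w, _, p, rfl, hp, by omega, hw2, hk2, fun x hx hxw hxg => ?_⟩
      obtain ⟨j, hj, rfl⟩ := hs x hx
      cases j with
      | zero => exact (hxw rfl).elim
      | succ j =>
        refine hkj j (lt_of_le_of_ne (by omega) ?_)
        rintro rfl
        exact hxg hk
    · rintro ⟨u, v, p, rfl, hp, hl, hu, hv, hi⟩
      cases p with
      | nil => simp at hl
      | @cons _ m _ hadj q =>
        rw [SimpleGraph.Walk.cons_isPath_iff] at hp
        have hi' : ∀ w ∈ q.support, w ≠ v → parentDeg r f w = 2 := fun w hw hwv =>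
          hi w (by simp [hw]) (fun he => hp.2 (he ▸ hw)) hwv
        rcases (parentGraph_adj hh).1 hadj with ⟨hur, hm⟩ | ⟨hmr, hm⟩
        · obtain ⟨k, hk, hk2⟩ := iterate_of_path_from_child hh hr q hp.1 hi' u hur hm hp.2
          subst hm
          exact ⟨u, ⟨hur, hu⟩, by rw [(hg u).unique ⟨k, hk, hv, hk2⟩]⟩
        · obtain ⟨hvr, k, hk, hk2⟩ := iterate_of_path_from_parent hh q hp.1 hi' u hmr hm hp.2
          exact ⟨v, ⟨hvr, hv⟩, by rw [(hg v).unique ⟨k, hk, hu, hk2⟩, Sym2.eq_swap]⟩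
  unfold numSegments
  rw [← himage]
  refine Set.InjOn.ncard_image fun x hx y hy hxy => ?_
  rcases Sym2.eq_iff.1 hxy with ⟨h1, -⟩ | ⟨h1, h2⟩
  · exact h1
  · have h3 := hrank x hx.1
    have h4 := hrank y hy.1
    rw [← h1] at h4
    rw [h2] at h3
    omega

end Segments

section Exchange

variable {V : Type*} [Fintype V] {r : V} {f : V → V} {h : V → ℕ}

open Classical in
/-- The second Zagreb index of the tree with root `r` and parent map `f`. -/
noncomputable def parentM2 (r : V) (f : V → V) : ℕ :=
  ∑ w ∈ univ.erase r, parentDeg r f w * parentDeg r f (f w)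

/-- No parent map of a chemical tree with the same non-root vertices of degree `2` has a larger
second Zagreb index. -/
def IsMaxParentMap (r : V) (f : V → V) : Prop :=
  ∀ (g : V → V) (h : V → ℕ), g r = r → (∀ w, w ≠ r → h (g w) < h w) →
    (∀ w, parentDeg r g w ≤ 4) → parentDeg r g r ≠ 2 →
    (∀ w, w ≠ r → (parentDeg r g w ≠ 2 ↔ parentDeg r f w ≠ 2)) → parentM2 r g ≤ parentM2 r f

lemma isMaxParentMap_of_forall_M2_le (hroot : f r = r) (hh : ∀ w, w ≠ r → h (f w) < h w)
    (hr : parentDeg r f r ≠ 2)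
    (hmax : ∀ T' : SimpleGraph V, IsChemicalTree T' →
      numSegments T' = numSegments (parentGraph r f) → M2 T' ≤ M2 (parentGraph r f)) :
    IsMaxParentMap r f := by
  intro g h' hg hh' h4 hr' hiff
  have := hmax (parentGraph r g)
    ⟨isTree_parentGraph hh', fun w => by rw [deg_parentGraph hh']; exact h4 w⟩ (by
      rw [numSegments_parentGraph hg hh' hr', numSegments_parentGraph hroot hh hr]
      congr 1
      ext w
      exact and_congr_right (hiff w))
  rwa [M2_parentGraph hh, M2_parentGraph hh'] at this

lemma parentM2_lt_of_sum_lt {g : V → V} (S : Finset V) (hS : r ∉ S)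
    (hle : ∀ w, w ≠ r → w ∉ S →
      parentDeg r f w * parentDeg r f (f w) ≤ parentDeg r g w * parentDeg r g (g w))
    (hlt : ∑ w ∈ S, parentDeg r f w * parentDeg r f (f w) <
      ∑ w ∈ S, parentDeg r g w * parentDeg r g (g w)) :
    parentM2 r f < parentM2 r g := by
  classical
  have hsub : S ⊆ univ.erase r := fun w hw =>
    mem_erase.2 ⟨fun he => hS (he ▸ hw), mem_univ w⟩
  unfold parentM2
  rw [← sum_sdiff hsub, ← sum_sdiff (f := fun w => parentDeg r g w * parentDeg r g (g w)) hsub]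
  refine add_lt_add_of_le_of_lt (sum_le_sum fun w hw => ?_) hlt
  obtain ⟨h1, h2⟩ := mem_sdiff.1 hw
  exact hle w (ne_of_mem_erase h1) h2

lemma one_le_parentDeg {w : V} (hw : w ≠ r) : 1 ≤ parentDeg r f w := by
  rw [parentDeg_of_ne hw]
  omega

open Classical in
/-- In a maximal tree rooted at a vertex of degree `3` with two branching children there are no two
further vertices of degree `3`. -/
lemma IsMaxParentMap.eq_of_parentDeg_eq_three (hm : IsMaxParentMap r f) (hroot : f r = r)
    (hh : ∀ w, w ≠ r → h (f w) < h w) (h4 : ∀ w, parentDeg r f w ≤ 4) {a b c : V}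
    (hab : a ≠ b) (hac : a ≠ c) (hbc : b ≠ c) (hch : children r f r = {a, b, c})
    (ha : 3 ≤ parentDeg r f a) (hb : 3 ≤ parentDeg r f b) {u v : V} (hu : u ≠ r) (hv : v ≠ r)
    (hu3 : parentDeg r f u = 3) (hv3 : parentDeg r f v = 3) : u = v := by
  wlog hle : h v ≤ h u generalizing u v
  · exact (this hv hu hv3 hu3 (by omega)).symm
  by_contra huv
  obtain ⟨x, y, hxy, hxs⟩ : ∃ x y, x ≠ y ∧ children r f u = {x, y} := by
    rw [parentDeg_of_ne hu] at hu3
    exact card_eq_two.1 (by omega)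
  have hr3 : parentDeg r f r = 3 := by
    rw [parentDeg_root, hch, card_eq_three.2 ⟨a, b, c, hab, hac, hbc, rfl⟩]
  obtain ⟨hxr, hfx⟩ : x ≠ r ∧ f x = u := mem_children.1 (by simp [hxs])
  obtain ⟨hyr, hfy⟩ : y ≠ r ∧ f y = u := mem_children.1 (by simp [hxs])
  obtain ⟨har, hfa⟩ : a ≠ r ∧ f a = r := mem_children.1 (by simp [hch])
  obtain ⟨hbr, hfb⟩ : b ≠ r ∧ f b = r := mem_children.1 (by simp [hch])
  obtain ⟨hcr, hfc⟩ : c ≠ r ∧ f c = r := mem_children.1 (by simp [hch])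
  have hxu : h u < h x := hfx ▸ hh x hxr
  have hyu : h u < h y := hfy ▸ hh y hyr
  obtain ⟨g, hg⟩ : ∃ g, g = Function.update (Function.update f x v) y r := ⟨_, rfl⟩
  have hgx : g x = v := by simp [hg, hxy]
  have hgy : g y = r := by simp [hg]
  have hgw : ∀ w, w ≠ x → w ≠ y → g w = f w := fun w h1 h2 => by simp [hg, h1, h2]
  have hdeg : ∀ w, parentDeg r g w + 2 * (if w = u then 1 else 0) =
      parentDeg r f w + (if w = v then 1 else 0) + if w = r then 1 else 0 := by
    intro w
    rw [hg]
    have h1 := parentDeg_update (f := f) hxr v w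
    have h2 := parentDeg_update (f := Function.update f x v) hyr r w
    rw [Function.update_of_ne hxy.symm, hfy] at h2
    rw [hfx] at h1
    omega
  have hgr4 : parentDeg r g r = 4 := by
    have := hdeg r
    simp [hu.symm, hv.symm] at this
    omega
  have hgu : parentDeg r g u = 1 := by
    have := hdeg u
    simp [hu, huv] at this
    omega
  have hgv : parentDeg r g v = 4 := by
    have := hdeg v
    simp [hv, Ne.symm huv] at this
    omega
  have hge : ∀ w, w ≠ u → parentDeg r f w ≤ parentDeg r g w := by
    intro w hw
    have := hdeg w
    simp only [hw, if_false] at this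
    omega
  have heq : ∀ w, w ≠ u → w ≠ v → w ≠ r → parentDeg r g w = parentDeg r f w := by
    intro w h1 h2 h3
    have := hdeg w
    simp only [h1, h2, h3, if_false] at this
    omega
  have hlt : parentM2 r f < parentM2 r g := by
    have hout : ∀ w, w ≠ u → w ≠ x → w ≠ y → w ≠ r →
        parentDeg r f w * parentDeg r f (f w) ≤ parentDeg r g w * parentDeg r g (g w) := by
      intro w h1 h2 h3 h4
      rw [hgw w h2 h3]
      refine Nat.mul_le_mul (hge w h1) (hge _ fun he => ?_)
      have : w ∈ children r f u := mem_children.2 ⟨h4, he⟩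
      simp [hxs, h2, h3] at this
    have hne : ∀ z, f z = r → z ≠ x ∧ z ≠ y := by
      intro z hz
      exact ⟨fun he => hu (by rw [← hfx, ← he, hz]), fun he => hu (by rw [← hfy, ← he, hz])⟩
    obtain ⟨hax, hay⟩ := hne a hfa
    obtain ⟨hbx, hby⟩ := hne b hfb
    obtain ⟨hcx, hcy⟩ := hne c hfc
    have hux : u ≠ x := fun he => by rw [← he] at hxu; omega
    have huy : u ≠ y := fun he => by rw [← he] at hyu; omega
    have hx1 := one_le_parentDeg (f := f) hxr
    have hy1 := one_le_parentDeg (f := f) hyr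
    have hc1 := one_le_parentDeg (f := f) hcr
    have hgx1 := hge x hux.symm
    have hgy1 := hge y huy.symm
    by_cases hua : u = a
    · subst hua
      have hgb := hge b hab.symm
      have hgc := hge c hac.symm
      refine parentM2_lt_of_sum_lt {u, b, c, x, y} (by simp [*, Ne.symm]) (fun w h1 h2 => ?_) ?_
      · simp only [mem_insert, mem_singleton, not_or] at h2
        exact hout w (by tauto) (by tauto) (by tauto) h1
      · clear hg
        simp [*]
        omega
    · by_cases hub : u = b
      · subst hub
        have hga := hge a hab
        have hgc := hge c hbc.symm
        refine parentM2_lt_of_sum_lt {a, u, c, x, y} (by simp [*, Ne.symm]) (fun w h1 h2 => ?_) ?_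
        · simp only [mem_insert, mem_singleton, not_or] at h2
          exact hout w (by tauto) (by tauto) (by tauto) h1
        · clear hg
          simp [*]
          omega
      · have hga := hge a (Ne.symm hua)
        have hgb := hge b (Ne.symm hub)
        by_cases huc : u = c
        · subst huc
          refine parentM2_lt_of_sum_lt {a, b, u, x, y} (by simp [*, Ne.symm]) (fun w h1 h2 => ?_) ?_
          · simp only [mem_insert, mem_singleton, not_or] at h2
            exact hout w (by tauto) (by tauto) (by tauto) h1
          · clear hg
            simp [*]
            omega
        · have hgc := hge c (Ne.symm huc)
          have hfu : f u ≠ u := fun he => by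
            have := hh u hu
            rw [he] at this
            omega
          have hgp := hge (f u) hfu
          have hp4 := h4 (f u)
          refine parentM2_lt_of_sum_lt {a, b, c, u, x, y} (by simp [*, Ne.symm])
            (fun w h1 h2 => ?_) ?_
          · simp only [mem_insert, mem_singleton, not_or] at h2
            exact hout w (by tauto) (by tauto) (by tauto) h1
          · clear hg
            simp [*, Ne.symm hua, Ne.symm hub, Ne.symm huc]
            omega
  refine absurd (hm g h ?_ ?_ ?_ ?_ ?_) hlt.not_ge
  · rw [hgw r hxr.symm hyr.symm, hroot]
  · intro w hw
    by_cases h1 : w = x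
    · subst h1
      rw [hgx]
      omega
    · by_cases h2 : w = y
      · subst h2
        rw [hgy]
        exact rank_root_lt hroot hh hw
      · rw [hgw w h1 h2]
        exact hh w hw
  · intro w
    by_cases h1 : w = u
    · rw [h1, hgu]
      omega
    · by_cases h2 : w = v
      · rw [h2, hgv]
      · by_cases h3 : w = r
        · rw [h3, hgr4]
        · rw [heq w h1 h2 h3]
          exact h4 w
  · omega
  · intro w hw
    by_cases h1 : w = u
    · rw [h1]
      omega
    · by_cases h2 : w = v
      · rw [h2]
        omega
      · rw [heq w h1 h2 hw]

open Classical in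
/-- In a maximal tree rooted at a vertex of degree `3` with children `a`, `b`, `c`, where `a` and
`b` have degree sum at least `7`, no vertex of degree `4` below `a` has only children of degree at
most `2`. -/
lemma IsMaxParentMap.false_of_parentDeg_eq_four (hm : IsMaxParentMap r f) (hroot : f r = r)
    (hh : ∀ w, w ≠ r → h (f w) < h w) (h4 : ∀ w, parentDeg r f w ≤ 4) {a b c : V}
    (hab : a ≠ b) (hac : a ≠ c) (hbc : b ≠ c) (hch : children r f r = {a, b, c})
    (hsum : 7 ≤ parentDeg r f a + parentDeg r f b) {u : V} (hu : u ≠ r)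
    (hu4 : parentDeg r f u = 4) (hub : u ≠ b) (huc : ∀ k, f^[k] u ≠ c)
    (hsmall : ∀ x ∈ children r f u, parentDeg r f x ≤ 2) : False := by
  obtain ⟨x, y, z, hxy, hxz, hyz, hxs⟩ :
      ∃ x y z, x ≠ y ∧ x ≠ z ∧ y ≠ z ∧ children r f u = {x, y, z} := by
    rw [parentDeg_of_ne hu] at hu4
    exact card_eq_three.1 (by omega)
  have hr3 : parentDeg r f r = 3 := by
    rw [parentDeg_root, hch, card_eq_three.2 ⟨a, b, c, hab, hac, hbc, rfl⟩]
  have hz2 := hsmall z (by simp [hxs])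
  obtain ⟨hxr, hfx⟩ : x ≠ r ∧ f x = u := mem_children.1 (by simp [hxs])
  obtain ⟨hyr, hfy⟩ : y ≠ r ∧ f y = u := mem_children.1 (by simp [hxs])
  obtain ⟨hzr, hfz⟩ : z ≠ r ∧ f z = u := mem_children.1 (by simp [hxs])
  obtain ⟨har, hfa⟩ : a ≠ r ∧ f a = r := mem_children.1 (by simp [hch])
  obtain ⟨hbr, hfb⟩ : b ≠ r ∧ f b = r := mem_children.1 (by simp [hch])
  obtain ⟨hcr, hfc⟩ : c ≠ r ∧ f c = r := mem_children.1 (by simp [hch])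
  have huc0 : u ≠ c := huc 0
  have hne : ∀ w, f w = r → w ≠ x ∧ w ≠ y ∧ w ≠ z := by
    intro w hw
    exact ⟨fun he => hu (by rw [← hfx, ← he, hw]), fun he => hu (by rw [← hfy, ← he, hw]),
      fun he => hu (by rw [← hfz, ← he, hw])⟩
  have hfne : ∀ w, w ≠ r → f w ≠ w := fun w hw he => by
    have := hh w hw
    rw [he] at this
    omega
  have hux : u ≠ x := fun he => hfne x hxr (hfx.trans he)
  have huy : u ≠ y := fun he => hfne y hyr (hfy.trans he)
  have huz : u ≠ z := fun he => hfne z hzr (hfz.trans he)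
  obtain ⟨hax, hay, haz⟩ := hne a hfa
  obtain ⟨hbx, hby, hbz⟩ := hne b hfb
  obtain ⟨hcx, hcy, hcz⟩ := hne c hfc
  obtain ⟨g, hg⟩ : ∃ g, g = Function.update (Function.update (Function.update f x r) y r) c u :=
    ⟨_, rfl⟩
  have hgx : g x = r := by simp [hg, hxy, hcx.symm]
  have hgy : g y = r := by simp [hg, hcy.symm]
  have hgc : g c = u := by simp [hg]
  have hgw : ∀ w, w ≠ x → w ≠ y → w ≠ c → g w = f w := fun w h1 h2 h3 => by
    simp [hg, h1, h2, h3]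
  have hdeg : ∀ w, parentDeg r g w + (if w = u then 1 else 0) =
      parentDeg r f w + if w = r then 1 else 0 := by
    intro w
    rw [hg]
    have h1 := parentDeg_update (f := f) hxr r w
    have h2 := parentDeg_update (f := Function.update f x r) hyr r w
    have h3 := parentDeg_update (f := Function.update (Function.update f x r) y r) hcr u w
    rw [Function.update_of_ne hcy, Function.update_of_ne hcx, hfc] at h3
    rw [Function.update_of_ne hxy.symm, hfy] at h2
    rw [hfx] at h1
    omega
  have hgr4 : parentDeg r g r = 4 := by
    have := hdeg r
    simp [hu.symm] at this
    omega
  have hgu : parentDeg r g u = 3 := by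
    have := hdeg u
    simp [hu] at this
    omega
  have heq : ∀ w, w ≠ u → w ≠ r → parentDeg r g w = parentDeg r f w := by
    intro w h1 h3
    have := hdeg w
    simp only [h1, h3, if_false] at this
    omega
  have hlt : parentM2 r f < parentM2 r g := by
    have hout : ∀ w, w ≠ a → w ≠ b → w ≠ c → w ≠ u → w ≠ x → w ≠ y → w ≠ z → w ≠ r →
        parentDeg r f w * parentDeg r f (f w) ≤ parentDeg r g w * parentDeg r g (g w) := by
      intro w hwa hwb hwc hwu hwx hwy hwz hwr
      rw [hgw w hwx hwy hwc, heq w hwu hwr, heq (f w)]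
      · intro he
        have : w ∈ children r f u := mem_children.2 ⟨hwr, he⟩
        simp [hxs, hwx, hwy, hwz] at this
      · intro he
        have : w ∈ children r f r := mem_children.2 ⟨hwr, he⟩
        simp [hch, hwa, hwb, hwc] at this
    have hga := hgw a hax hay hac
    have hgb := hgw b hbx hby hbc
    have hgz := hgw z hxz.symm hyz.symm hcz.symm
    have hgu' := hgw u hux huy huc0
    have hdb := heq b hub.symm hbr
    have hdc := heq c huc0.symm hcr
    have hdx := heq x hux.symm hxr
    have hdy := heq y huy.symm hyr
    have hdz := heq z huz.symm hzr
    have h4a := h4 a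
    by_cases hua : u = a
    · subst hua
      refine parentM2_lt_of_sum_lt {u, b, c, x, y, z} (by simp [*, Ne.symm])
        (fun w h1 h2 => ?_) ?_
      · simp only [mem_insert, mem_singleton, not_or] at h2
        exact hout w (by tauto) (by tauto) (by tauto) (by tauto) (by tauto) (by tauto)
          (by tauto) h1
      · clear hg
        simp [*]
        omega
    · have hda := heq a (Ne.symm hua) har
      have hfur : f u ≠ r := by
        intro he
        have : u ∈ children r f r := mem_children.2 ⟨hu, he⟩
        simp [hch, hua, hub, huc0] at this
      have hdp := heq (f u) (hfne u hu) hfur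
      have h4p := h4 (f u)
      refine parentM2_lt_of_sum_lt {a, b, c, u, x, y, z} (by simp [*, Ne.symm])
        (fun w h1 h2 => ?_) ?_
      · simp only [mem_insert, mem_singleton, not_or] at h2
        exact hout w (by tauto) (by tauto) (by tauto) (by tauto) (by tauto) (by tauto)
          (by tauto) h1
      · clear hg
        simp [*, Ne.symm hua, Ne.symm hub, Ne.symm huc0]
        omega
  have hrootc : ∀ k, f^[k] r ≠ c := fun k he => hcr (by rw [← he, Function.iterate_fixed hroot])
  refine absurd (hm g (fun w => h w + if ∃ k, f^[k] w = c then h u + 1 else 0) ?_ ?_ ?_ ?_ ?_)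
    hlt.not_ge
  · rw [hgw r hxr.symm hyr.symm hcr.symm, hroot]
  · intro w hw
    have hr0 : ¬ ∃ k, f^[k] r = c := fun ⟨k, hk⟩ => hrootc k hk
    have hu0 : ¬ ∃ k, f^[k] u = c := fun ⟨k, hk⟩ => huc k hk
    have hwr := rank_root_lt hroot hh hw
    by_cases h1 : w = x
    · rw [h1, hgx, if_neg hr0, ← h1]
      omega
    · by_cases h2 : w = y
      · rw [h2, hgy, if_neg hr0, ← h2]
        omega
      · by_cases h3 : w = c
        · rw [h3, hgc, if_neg hu0, if_pos ⟨0, rfl⟩]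
          omega
        · rw [hgw w h1 h2 h3]
          have hiff : (∃ k, f^[k] w = c) ↔ ∃ k, f^[k] (f w) = c := by
            constructor
            · rintro ⟨k, hk⟩
              cases k with
              | zero => exact (h3 hk).elim
              | succ k => exact ⟨k, hk⟩
            · rintro ⟨k, hk⟩
              exact ⟨k + 1, hk⟩
          simp only [hiff]
          exact Nat.add_lt_add_right (hh w hw) _
  · intro w
    by_cases h1 : w = u
    · rw [h1, hgu]
      omega
    · by_cases h3 : w = r
      · rw [h3, hgr4]
      · rw [heq w h1 h3]
        exact h4 w
  · omega
  · intro w hw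
    by_cases h1 : w = u
    · rw [h1]
      omega
    · rw [heq w h1 hw]

/-- Below every branching vertex there is a branching vertex without branching children. -/
lemma exists_branching_below (hroot : f r = r) (hh : ∀ w, w ≠ r → h (f w) < h w) {a : V}
    (har : a ≠ r) (ha : 3 ≤ parentDeg r f a) :
    ∃ u, u ≠ r ∧ 3 ≤ parentDeg r f u ∧ (∃ k, f^[k] u = a) ∧
      ∀ x ∈ children r f u, parentDeg r f x ≤ 2 := by
  obtain ⟨u, ⟨hu3, k, hk⟩, hmax⟩ := Set.exists_max_image
    {w | 3 ≤ parentDeg r f w ∧ ∃ k, f^[k] w = a} h (Set.toFinite _) ⟨a, ha, 0, rfl⟩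
  refine ⟨u, ?_, hu3, ⟨k, hk⟩, fun x hx => ?_⟩
  · rintro rfl
    exact har (by rw [← hk, Function.iterate_fixed hroot])
  · obtain ⟨hxr, hxu⟩ := mem_children.1 hx
    by_contra hlt
    have h1 := hmax x ⟨by omega, k + 1, by rw [Function.iterate_succ_apply, hxu, hk]⟩
    have h2 := hh x hxr
    rw [hxu] at h2
    omega

end Exchange

end ChemTree

theorem stmt_9 {V : Type*} [Fintype V] (n k : ℕ)
    (hcard : Fintype.card V = n) (hk3 : 3 ≤ k) (hkn : k + 1 ≤ n)
    (T : SimpleGraph V) (hT : IsChemicalTree T) (hseg : numSegments T = k)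
    (hmax : ∀ T' : SimpleGraph V, IsChemicalTree T' → numSegments T' = k →
      M2 T' ≤ M2 T) :
    ∀ v : V, deg T v = 3 → {w | T.Adj v w ∧ 3 ≤ deg T w}.ncard ≤ 1 := by
  classical
  subst hseg
  intro r hr
  by_contra hcon
  obtain ⟨f, h, hroot, hh, rfl⟩ := exists_parentGraph_eq hT.1 r
  simp only [deg_parentGraph hh] at hr hcon
  have h4 : ∀ w, parentDeg r f w ≤ 4 := fun w => deg_parentGraph hh w ▸ hT.2 w
  have hm := isMaxParentMap_of_forall_M2_le hroot hh (by omega) hmax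
  obtain ⟨a, b, ⟨haadj, ha⟩, ⟨hbadj, hb⟩, hab⟩ :=
    (Set.one_lt_ncard_iff (Set.toFinite _)).1 (not_le.1 hcon)
  have hroot_adj : ∀ w, (parentGraph r f).Adj r w → w ∈ children r f r := by
    intro w hw
    rcases (parentGraph_adj hh).1 hw with ⟨h1, -⟩ | h1
    · exact (h1 rfl).elim
    · exact mem_children.2 h1
  have hac := hroot_adj a haadj
  have hbc := hroot_adj b hbadj
  rw [parentDeg_root] at hr
  obtain ⟨c, hc⟩ : ∃ c, ((children r f r).erase a).erase b = {c} := by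
    rw [← Finset.card_eq_one, Finset.card_erase_of_mem (Finset.mem_erase.2 ⟨hab.symm, hbc⟩),
      Finset.card_erase_of_mem hac, hr]
  have hcmem : c ∈ ((children r f r).erase a).erase b := by simp [hc]
  simp only [Finset.mem_erase] at hcmem
  obtain ⟨hcb, hca, hcc⟩ := hcmem
  have hch : children r f r = {a, b, c} := by
    rw [← Finset.insert_erase hac, ← Finset.insert_erase (Finset.mem_erase.2 ⟨hab.symm, hbc⟩), hc]
  obtain ⟨har, hfa⟩ := mem_children.1 hac
  obtain ⟨hbr, hfb⟩ := mem_children.1 hbc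
  obtain ⟨hcr, hfc⟩ := mem_children.1 hcc
  obtain ⟨u, hur, hu3, hua, husmall⟩ := exists_branching_below hroot hh har ha
  obtain ⟨v, hvr, hv3, hvb, hvsmall⟩ := exists_branching_below hroot hh hbr hb
  have hub := iterate_ne_of_iterate_eq hroot hfa hfb har hbr hab hua
  have huc := iterate_ne_of_iterate_eq hroot hfa hfc har hcr hca.symm hua
  have hva := iterate_ne_of_iterate_eq hroot hfb hfa hbr har hab.symm hvb
  have hvc := iterate_ne_of_iterate_eq hroot hfb hfc hbr hcr hcb.symm hvb
  have huv : u ≠ v := by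
    rintro rfl
    obtain ⟨k, hk⟩ := hvb
    exact hub k hk
  have hsum : 7 ≤ parentDeg r f a + parentDeg r f b := by
    by_contra hlt
    exact hab (hm.eq_of_parentDeg_eq_three hroot hh h4 hab hca.symm hcb.symm hch ha hb har hbr
      (by omega) (by omega))
  by_cases hu4 : parentDeg r f u = 4
  · exact hm.false_of_parentDeg_eq_four hroot hh h4 hab hca.symm hcb.symm hch hsum hur hu4
      (hub 0) huc husmall
  by_cases hv4 : parentDeg r f v = 4
  · exact hm.false_of_parentDeg_eq_four hroot hh h4 hab.symm hcb.symm hca.symm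
      (hch.trans (Finset.insert_comm a b {c})) (by omega) hvr hv4 (hva 0) hvc hvsmall
  have hu4' := h4 u
  have hv4' := h4 v
  exact huv (hm.eq_of_parentDeg_eq_three hroot hh h4 hab hca.symm hcb.symm hch ha hb hur hvr
    (by omega) (by omega))
end

section
/- Let 3 ≤ k ≤ n−1 and let T be an n-vertex chemical tree with exactly k segments such that M2(T') ≤ M2(T) for every n-vertex chemical tree T' with exactly k segments. If the maximum degree of T is 4, then the subgraph of T induced by the vertices of degree 4 is a tree (in particular, it is connected). -/
open SimpleGraph

namespace ChemTree

variable {V : Type*}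

theorem eq_or_eq_of_mem_support_of_adj {G : SimpleGraph V} (hG : G.IsAcyclic) {u v w : V}
    {p : G.Walk u v} (hp : p.IsPath) (h : G.Adj u v) (hw : w ∈ p.support) : w = u ∨ w = v := by
  have := congrArg Subtype.val ((hG.subsingleton_path u v).elim ⟨p, hp⟩ ⟨h.toWalk, h.isPath_toWalk⟩)
  simp only at this
  subst this
  simpa using hw

theorem exists_adj_not_mem_support {G : SimpleGraph V} (hG : G.IsAcyclic) {u v : V}
    {p : G.Walk u v} (hp : p.IsPath) (hnil : ¬ p.Nil) (hu : 2 ≤ deg G u) :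
    ∃ y, G.Adj u y ∧ y ∉ p.support := by
  classical
  cases p with
  | nil => simp at hnil
  | @cons _ c _ h q =>
    obtain ⟨y, hy, hyc⟩ := Set.exists_ne_of_one_lt_ncard (s := G.neighborSet u) hu c
    refine ⟨y, hy, fun hmem => ?_⟩
    rw [Walk.support_cons, List.mem_cons] at hmem
    rw [Walk.cons_isPath_iff] at hp
    rcases hmem with rfl | hmem
    · exact G.loopless.irrefl _ hy
    · have hpath : (Walk.cons h (q.takeUntil y hmem)).IsPath := by
        rw [Walk.cons_isPath_iff]
        exact ⟨hp.1.takeUntil hmem, fun h' => hp.2 (q.support_takeUntil_subset_support hmem h')⟩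
      rcases eq_or_eq_of_mem_support_of_adj hG hpath hy (w := c) (by simp) with h' | h'
      · exact h.ne h'.symm
      · exact hyc h'.symm

theorem eq_end_of_same_start {G : SimpleGraph V} {x u u' : V} (p : G.Walk x u) (q : G.Walk x u')
    {v : V} (hvx : G.Adj v x) (hp : p.IsPath) (hq : q.IsPath)
    (hvp : v ∉ p.support) (hvq : v ∉ q.support)
    (hu : deg G u ≠ 2) (hu' : deg G u' ≠ 2)
    (hpi : ∀ w ∈ p.support, w ≠ u → deg G w = 2)
    (hqi : ∀ w ∈ q.support, w ≠ u' → deg G w = 2) : u = u' := by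
  induction p generalizing v with
  | nil =>
    by_contra hne
    exact hu (hqi _ q.start_mem_support hne)
  | @cons x y u h p ih =>
    have hx : deg G x = 2 := hpi x (by simp) (by
      rintro rfl
      rw [Walk.cons_isPath_iff] at hp
      exact hp.2 p.end_mem_support)
    cases q with
    | nil => exact absurd hx hu'
    | @cons _ y' _ h' q =>
      have hyy : y = y' := by
        obtain ⟨a, b, -, hab⟩ := Set.ncard_eq_two.1 hx
        have h1 : v ∈ G.neighborSet x := hvx.symm
        have h2 : y ∈ G.neighborSet x := h
        have h3 : y' ∈ G.neighborSet x := h'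
        have h4 : v ≠ y := by rintro rfl; simp at hvp
        have h5 : v ≠ y' := by rintro rfl; simp at hvq
        rw [hab] at h1 h2 h3
        simp only [Set.mem_insert_iff, Set.mem_singleton_iff] at h1 h2 h3
        grind
      subst hyy
      rw [Walk.cons_isPath_iff] at hp hq
      exact ih q h hp.1 hq.1 hp.2 hq.2 hu
        (fun w hw => hpi w (by simp [hw])) (fun w hw => hqi w (by simp [hw]))

theorem exists_segment_extending [Fintype V] {G : SimpleGraph V} (hG : G.IsAcyclic) (m : ℕ)
    {u v : V} (p : G.Walk u v) (hm : Fintype.card V ≤ m + p.length) (hp : p.IsPath)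
    (hnil : ¬ p.Nil) (hv : deg G v ≠ 2)
    (hpi : ∀ w ∈ p.support, w ≠ u → w ≠ v → deg G w = 2) :
    ∃ (u' : V) (p' : G.Walk u' v), IsSegment G p' ∧ p'.penultimate = p.penultimate := by
  induction m generalizing u with
  | zero => have := hp.length_lt; omega
  | succ m ih =>
    by_cases hu : deg G u = 2
    · obtain ⟨y, hy, hyp⟩ := exists_adj_not_mem_support hG hp hnil hu.ge
      obtain ⟨u', p', hp', he⟩ := ih (Walk.cons hy.symm p)
        (by rw [Walk.length_cons]; omega) (by rw [Walk.cons_isPath_iff]; exact ⟨hp, hyp⟩)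
        (by simp) (by
          intro w hw hwy hwv
          rw [Walk.support_cons, List.mem_cons] at hw
          rcases hw with rfl | hw
          · exact absurd rfl hwy
          · by_cases hwu : w = u
            · rw [hwu, hu]
            · exact hpi w hw hwu hwv)
      exact ⟨u', p', hp', by rw [he, Walk.penultimate_cons_of_not_nil _ _ hnil]⟩
    · exact ⟨u, p, ⟨hp, Walk.not_nil_iff_lt_length.1 hnil, hu, hv, hpi⟩, rfl⟩

theorem IsSegment.reverse {G : SimpleGraph V} {u v : V} {p : G.Walk u v} (hp : IsSegment G p) :
    IsSegment G p.reverse := by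
  obtain ⟨h1, h2, h3, h4, h5⟩ := hp
  refine ⟨h1.reverse, by simpa using h2, h4, h3, fun w hw h h' => h5 w (by simpa using hw) h' h⟩

/-- The graph joining the end vertices of each segment. -/
def segmentGraph (G : SimpleGraph V) : SimpleGraph V where
  Adj u v := ∃ p : G.Walk u v, IsSegment G p
  symm := ⟨fun _ _ ⟨_, hp⟩ => ⟨_, hp.reverse⟩⟩
  loopless := ⟨fun _ ⟨p, hp⟩ => by
    exact Walk.not_nil_iff_lt_length.2 hp.2.1 (Walk.isPath_iff_nil.1 hp.1)⟩

theorem numSegments_eq_ncard_edgeSet (G : SimpleGraph V) :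
    numSegments G = (segmentGraph G).edgeSet.ncard := by
  unfold numSegments
  congr 1
  ext s
  induction s using Sym2.ind with
  | _ a b =>
    rw [mem_edgeSet]
    constructor
    · rintro ⟨u, v, p, he, hp⟩
      rcases Sym2.eq_iff.1 he with ⟨rfl, rfl⟩ | ⟨rfl, rfl⟩
      · exact ⟨p, hp⟩
      · exact ⟨_, hp.reverse⟩
    · rintro ⟨p, hp⟩
      exact ⟨a, b, p, rfl, hp⟩

theorem deg_segmentGraph [Fintype V] {G : SimpleGraph V} (hG : G.IsAcyclic) (v : V) :
    deg (segmentGraph G) v = if deg G v = 2 then 0 else deg G v := by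
  split_ifs with hv
  · have : (segmentGraph G).neighborSet v = ∅ := by
      ext u
      simp only [mem_neighborSet, Set.mem_empty_iff_false, iff_false]
      rintro ⟨p, hp⟩
      exact hp.2.2.1 hv
    simp [deg, this]
  · refine Set.ncard_congr (fun u hu => (Exists.choose hu : G.Walk v u).snd) ?_ ?_ ?_
    · intro u hu
      have hs := Exists.choose_spec hu
      exact Walk.adj_snd (Walk.not_nil_iff_lt_length.2 hs.2.1)
    · intro u u' hu hu' he
      have hs := Exists.choose_spec hu
      have hs' := Exists.choose_spec hu'
      generalize Exists.choose hu = p at *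
      generalize Exists.choose hu' = q at *
      cases p with
      | nil => exact absurd hs.2.1 (by simp)
      | cons h p =>
        cases q with
        | nil => exact absurd hs'.2.1 (by simp)
        | cons h' q =>
          simp only [Walk.snd_cons] at he
          subst he
          obtain ⟨h1, -, -, h4, h5⟩ := hs
          obtain ⟨h1', -, -, h4', h5'⟩ := hs'
          rw [Walk.cons_isPath_iff] at h1 h1'
          refine eq_end_of_same_start p q h h1.1 h1'.1 h1.2 h1'.2 h4 h4' ?_ ?_
          · exact fun w hw => h5 w (by simp [hw]) (by rintro rfl; exact h1.2 hw)
          · exact fun w hw => h5' w (by simp [hw]) (by rintro rfl; exact h1'.2 hw)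
    · intro x hx
      have hx' : G.Adj x v := Adj.symm hx
      obtain ⟨u, p, hp, he⟩ := exists_segment_extending hG (Fintype.card V) hx'.toWalk
        (by omega) hx'.isPath_toWalk (by simp) hv (by
          intro w hw h1 h2
          simp at hw
          tauto)
      have hu : (segmentGraph G).Adj v u := ⟨_, hp.reverse⟩
      refine ⟨u, hu, ?_⟩
      have hc : hu.choose = p.reverse := congrArg Subtype.val
        ((hG.subsingleton_path _ _).elim ⟨_, hu.choose_spec.1⟩ ⟨_, hp.reverse.1⟩)
      rw [hc, Walk.snd_reverse, he]
      rfl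

theorem sum_deg [Fintype V] (G : SimpleGraph V) : ∑ v, deg G v = 2 * G.edgeSet.ncard := by
  classical
  have h := G.sum_degrees_eq_twice_card_edges
  rw [← Set.ncard_coe_finset, coe_edgeFinset] at h
  rw [← h]
  refine Finset.sum_congr rfl fun v _ => ?_
  rw [deg, ← card_neighborFinset_eq_degree, ← Set.ncard_coe_finset, coe_neighborFinset]

theorem numSegments_eq_of_deg_eq [Fintype V] {G G' : SimpleGraph V} (hG : G.IsAcyclic)
    (hG' : G'.IsAcyclic) (h : ∀ v, deg G v = deg G' v) : numSegments G = numSegments G' := by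
  have h1 := sum_deg (segmentGraph G)
  have h2 := sum_deg (segmentGraph G')
  simp only [deg_segmentGraph hG, deg_segmentGraph hG', h] at h1 h2
  rw [numSegments_eq_ncard_edgeSet, numSegments_eq_ncard_edgeSet]
  omega

/-- The graph obtained by replacing the edges `ax` and `by` with `ab` and `xy`. -/
def switch (T : SimpleGraph V) (a x b y : V) : SimpleGraph V :=
  fromEdgeSet (insert s(a, b) (insert s(x, y) (T.edgeSet \ {s(a, x), s(b, y)})))

section Switch

variable {T : SimpleGraph V} {a x b y : V}

theorem edgeSet_switch (hab : a ≠ b) (hxy : x ≠ y) : (switch T a x b y).edgeSet =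
    insert s(a, b) (insert s(x, y) (T.edgeSet \ {s(a, x), s(b, y)})) := by
  rw [switch, edgeSet_fromEdgeSet, sdiff_eq_left, Set.disjoint_left]
  intro e he hd
  rcases he with rfl | rfl | he
  · exact hab (by simpa using hd)
  · exact hxy (by simpa using hd)
  · exact T.not_isDiag_of_mem_edgeSet he.1 hd

theorem deg_switch [Finite V] (hax : T.Adj a x) (hby : T.Adj b y) (hnab : ¬ T.Adj a b)
    (hnxy : ¬ T.Adj x y) (hab : a ≠ b) (hxy : x ≠ y) (hay : a ≠ y) (hxb : x ≠ b) (v : V) :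
    deg (switch T a x b y) v = deg T v := by
  have hax' := hax.ne
  have hby' := hby.ne
  have hadj : ∀ u w, (switch T a x b y).Adj u w ↔ s(u, w) = s(a, b) ∨ s(u, w) = s(x, y) ∨
      (T.Adj u w ∧ ¬ (s(u, w) = s(a, x) ∨ s(u, w) = s(b, y))) := by
    intro u w
    rw [← mem_edgeSet, edgeSet_switch hab hxy]
    simp
  have key : ∀ c d, c ∉ T.neighborSet v → d ∈ T.neighborSet v →
      (switch T a x b y).neighborSet v = insert c (T.neighborSet v \ {d}) →
      deg (switch T a x b y) v = deg T v := by
    intro c d hc hd he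
    rw [deg, he, Set.ncard_exchange hc hd, deg]
  by_cases hva : v = a
  · subst hva
    refine key b x hnab hax ?_
    ext w
    simp only [mem_neighborSet, hadj, Sym2.eq_iff, Set.mem_insert_iff, Set.mem_sdiff,
      Set.mem_singleton_iff]
    grind
  by_cases hvb : v = b
  · subst hvb
    refine key a y (fun h => hnab (Adj.symm h)) hby ?_
    ext w
    simp only [mem_neighborSet, hadj, Sym2.eq_iff, Set.mem_insert_iff, Set.mem_sdiff,
      Set.mem_singleton_iff]
    grind
  by_cases hvx : v = x
  · subst hvx
    refine key y a hnxy hax.symm ?_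
    ext w
    simp only [mem_neighborSet, hadj, Sym2.eq_iff, Set.mem_insert_iff, Set.mem_sdiff,
      Set.mem_singleton_iff]
    grind
  by_cases hvy : v = y
  · subst hvy
    refine key x b (fun h => hnxy (Adj.symm h)) hby.symm ?_
    ext w
    simp only [mem_neighborSet, hadj, Sym2.eq_iff, Set.mem_insert_iff, Set.mem_sdiff,
      Set.mem_singleton_iff]
    grind
  rw [deg, deg]
  congr 1
  ext w
  simp only [mem_neighborSet, hadj, Sym2.eq_iff]
  grind

theorem isTree_switch [Finite V] (hT : T.IsTree) (hax : T.Adj a x) (hby : T.Adj b y)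
    (hnab : ¬ T.Adj a b) (hnxy : ¬ T.Adj x y) (hab : a ≠ b) (hxy : x ≠ y) (hxb : x ≠ b)
    (q : T.Walk b x) (haq : a ∉ q.support) (hyq : y ∉ q.support) :
    (switch T a x b y).IsTree := by
  have hE := edgeSet_switch (T := T) hab hxy
  rw [isTree_iff_connected_and_card] at hT ⊢
  constructor
  · have hab' : (switch T a x b y).Adj a b := by
      rw [← mem_edgeSet, hE]; simp
    have hxy' : (switch T a x b y).Adj x y := by
      rw [← mem_edgeSet, hE]; simp
    have hbx : (switch T a x b y).Reachable b x := by
      refine ⟨q.transfer _ fun e he => ?_⟩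
      rw [hE]
      refine Or.inr (Or.inr ⟨q.edges_subset_edgeSet he, ?_⟩)
      rintro (rfl | rfl)
      · exact haq (q.fst_mem_support_of_mem_edges he)
      · exact hyq (q.snd_mem_support_of_mem_edges he)
    have hstep : ∀ u v, T.Adj u v → (switch T a x b y).Reachable u v := by
      intro u v huv
      by_cases h1 : s(u, v) = s(a, x)
      · have := hab'.reachable.trans hbx
        rcases Sym2.eq_iff.1 h1 with ⟨rfl, rfl⟩ | ⟨rfl, rfl⟩
        exacts [this, this.symm]
      by_cases h2 : s(u, v) = s(b, y)
      · have := hbx.trans hxy'.reachable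
        rcases Sym2.eq_iff.1 h2 with ⟨rfl, rfl⟩ | ⟨rfl, rfl⟩
        exacts [this, this.symm]
      refine Adj.reachable ?_
      rw [← mem_edgeSet, hE]
      refine Or.inr (Or.inr ⟨huv, ?_⟩)
      rintro (h | h)
      exacts [h1 h, h2 h]
    have := hT.1.nonempty
    refine ⟨fun u v => ?_⟩
    obtain ⟨p⟩ := hT.1.preconnected u v
    induction p with
    | nil => exact Reachable.refl _
    | cons h _ ih => exact (hstep _ _ h).trans ih
  · rw [← hT.2, Nat.card_coe_set_eq, Nat.card_coe_set_eq, hE]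
    have h1 : s(x, y) ∉ T.edgeSet \ {s(a, x), s(b, y)} := fun h => hnxy h.1
    have h2 : s(a, b) ∉ insert s(x, y) (T.edgeSet \ {s(a, x), s(b, y)}) := by
      rintro (h | h)
      · rcases Sym2.eq_iff.1 h with ⟨rfl, rfl⟩ | ⟨rfl, rfl⟩
        exacts [hax.ne rfl, hxb rfl]
      · exact hnab h.1
    have h3 : ({s(a, x), s(b, y)} : Set (Sym2 V)) ⊆ T.edgeSet := by
      rintro e (rfl | rfl)
      exacts [hax, hby]
    have h4 : s(a, x) ≠ s(b, y) := by
      intro h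
      rcases Sym2.eq_iff.1 h with ⟨rfl, rfl⟩ | ⟨rfl, rfl⟩
      exacts [hab rfl, hxb rfl]
    have h5 := Set.ncard_sdiff_add_ncard_of_subset h3
    rw [Set.ncard_pair h4] at h5
    rw [Set.ncard_insert_of_notMem h2, Set.ncard_insert_of_notMem h1]
    omega

theorem M2_lt_M2_switch [Fintype V] (hax : T.Adj a x) (hby : T.Adj b y) (hnab : ¬ T.Adj a b)
    (hnxy : ¬ T.Adj x y) (hab : a ≠ b) (hxy : x ≠ y) (hay : a ≠ y) (hxb : x ≠ b)
    (hdxb : deg T x < deg T b) (hdya : deg T y < deg T a) :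
    M2 T < M2 (switch T a x b y) := by
  classical
  have hdeg := deg_switch hax hby hnab hnxy hab hxy hay hxb
  unfold M2
  simp only [hdeg]
  set f : Sym2 V → ℕ :=
    Sym2.lift ⟨fun u w => deg T u * deg T w, fun u w => Nat.mul_comm _ _⟩ with hf
  set E := (Set.toFinite T.edgeSet).toFinset with hEdef
  have hE' : (Set.toFinite (switch T a x b y).edgeSet).toFinset =
      insert s(a, b) (insert s(x, y) (E \ {s(a, x), s(b, y)})) := by
    ext e
    simp [hEdef, edgeSet_switch hab hxy]
  have h1 : s(x, y) ∉ E \ {s(a, x), s(b, y)} := by simp [hEdef, hnxy]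
  have h4 : s(a, x) ≠ s(b, y) := by
    intro h
    rcases Sym2.eq_iff.1 h with ⟨rfl, rfl⟩ | ⟨rfl, rfl⟩
    exacts [hab rfl, hxb rfl]
  have h2 : s(a, b) ∉ insert s(x, y) (E \ {s(a, x), s(b, y)}) := by
    rw [Finset.mem_insert]
    rintro (h | h)
    · rcases Sym2.eq_iff.1 h with ⟨rfl, rfl⟩ | ⟨rfl, rfl⟩
      exacts [hax.ne rfl, hxb rfl]
    · simp [hEdef, hnab] at h
  have h3 : ({s(a, x), s(b, y)} : Finset (Sym2 V)) ⊆ E := by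
    intro e he
    rw [Finset.mem_insert, Finset.mem_singleton] at he
    rcases he with rfl | rfl
    · simpa [hEdef] using hax
    · simpa [hEdef] using hby
  have h5 := Finset.sum_sdiff (f := f) h3
  rw [Finset.sum_pair h4] at h5
  rw [hE', Finset.sum_insert h2, Finset.sum_insert h1, ← h5]
  simp only [hf, Sym2.lift_mk]
  nlinarith

end Switch

/-- In an `M2`-maximal chemical tree, the degree of a vertex next to one of maximum degree on a
path between two vertices of maximum degree is again the maximum degree. -/
theorem deg_eq_four_of_adj_of_path [Fintype V] {T : SimpleGraph V} (hT : IsChemicalTree T)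
    (hmax : ∀ T' : SimpleGraph V, IsChemicalTree T' → numSegments T' = numSegments T →
      M2 T' ≤ M2 T) {a x : V} (hxa : T.Adj x a) (ha : deg T a = 4) (m : ℕ) {b : V}
    (q : T.Walk b x) (hm : Fintype.card V ≤ m + q.length) (hq : q.IsPath) (haq : a ∉ q.support)
    (hb : deg T b = 4) : deg T x = 4 := by
  induction m generalizing b with
  | zero => have := hq.length_lt; omega
  | succ m ih =>
    by_contra hx
    have hacyc := hT.1.isAcyclic
    have hqa : (q.concat hxa).IsPath := by
      rw [Walk.concat_isPath_iff]
      exact ⟨hq, haq⟩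
    obtain ⟨y, hy, hyq⟩ := exists_adj_not_mem_support hacyc hqa
      (by rw [Walk.not_nil_iff_lt_length, Walk.length_concat]; omega) (by omega)
    simp only [Walk.support_concat, List.mem_append, List.mem_singleton,
      not_or] at hyq
    have hyqp : (Walk.cons hy.symm q).IsPath := by
      rw [Walk.cons_isPath_iff]
      exact ⟨hq, hyq.1⟩
    by_cases hdy : deg T y = 4
    · refine hx (ih (Walk.cons hy.symm q) (by rw [Walk.length_cons]; omega) hyqp ?_ hdy)
      simpa using ⟨Ne.symm hyq.2, haq⟩
    have hxb : x ≠ b := by rintro rfl; exact hx hb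
    have hab : a ≠ b := by rintro rfl; exact haq q.start_mem_support
    have hxy : x ≠ y := by rintro rfl; exact hyq.1 q.end_mem_support
    have hnab : ¬ T.Adj a b := by
      intro h
      rcases eq_or_eq_of_mem_support_of_adj hacyc hqa h.symm (w := x) (by simp) with h' | h'
      exacts [hxb h', hxa.ne h']
    have hnxy : ¬ T.Adj x y := by
      intro h
      rcases eq_or_eq_of_mem_support_of_adj hacyc hyqp h.symm (w := b) (by simp) with h' | h'
      exacts [hy.ne h', hxb h'.symm]
    have htree := isTree_switch hT.1 hxa.symm hy hnab hnxy hab hxy hxb q haq hyq.1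
    have hdeg := deg_switch hxa.symm hy hnab hnxy hab hxy (Ne.symm hyq.2) hxb
    have hlt := M2_lt_M2_switch hxa.symm hy hnab hnxy hab hxy (Ne.symm hyq.2) hxb
      (by have := hT.2 x; omega) (by have := hT.2 y; omega)
    exact absurd (hmax _ ⟨htree, fun v => (hdeg v).trans_le (hT.2 v)⟩
      (numSegments_eq_of_deg_eq htree.isAcyclic hacyc hdeg)) hlt.not_ge

theorem reachable_induce_of_path [Fintype V] {T : SimpleGraph V} (hT : IsChemicalTree T)
    (hmax : ∀ T' : SimpleGraph V, IsChemicalTree T' → numSegments T' = numSegments T →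
      M2 T' ≤ M2 T) {a b : V} (p : T.Walk a b) (hp : p.IsPath) (ha : deg T a = 4)
    (hb : deg T b = 4) : (T.induce {v | deg T v = 4}).Reachable ⟨a, ha⟩ ⟨b, hb⟩ := by
  induction p with
  | nil => exact Reachable.refl _
  | @cons a x b h p ih =>
    rw [Walk.cons_isPath_iff] at hp
    have hx : deg T x = 4 := deg_eq_four_of_adj_of_path hT hmax h.symm ha (Fintype.card V)
      p.reverse (by omega) hp.1.reverse (by simpa using hp.2) hb
    have hadj : (T.induce {v | deg T v = 4}).Adj ⟨a, ha⟩ ⟨x, hx⟩ := h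
    exact hadj.reachable.trans (ih hp.1 hx hb)

end ChemTree

open ChemTree

theorem stmt_10 {V : Type*} [Fintype V] (n k : ℕ)
    (hcard : Fintype.card V = n) (hk3 : 3 ≤ k) (hkn : k + 1 ≤ n)
    (T : SimpleGraph V) (hT : IsChemicalTree T) (hseg : numSegments T = k)
    (hmax : ∀ T' : SimpleGraph V, IsChemicalTree T' → numSegments T' = k →
      M2 T' ≤ M2 T)
    (hmaxdeg : ∃ v : V, deg T v = 4) :
    (T.induce {v | deg T v = 4}).IsTree := by
  subst hseg
  obtain ⟨v, hv⟩ := hmaxdeg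
  have : Nonempty {v | deg T v = 4} := ⟨⟨v, hv⟩⟩
  refine ⟨⟨fun a b => ?_⟩, hT.1.isAcyclic.induce _⟩
  obtain ⟨p, hp, -⟩ := hT.1.existsUnique_path a.1 b.1
  exact reachable_induce_of_path hT hmax p hp a.2 b.2
end

section
/- Let 1 ≤ b < n/2 − 1 and let T be an n-vertex chemical tree with exactly b branching vertices such that either M1(T') ≤ M1(T) for every n-vertex chemical tree T' with exactly b branching vertices, or M2(T') ≤ M2(T) for every n-vertex chemical tree T' with exactly b branching vertices. Then T does not contain vertices of degree 2 and of degree 3 simultaneously; that is, if T contains a vertex of degree 2, then T contains no vertex of degree 3. -/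
open SimpleGraph

namespace ChemTree

/-- The graph obtained from `G` by replacing the edge `ux` by the edge `vx`. -/
def moveEdge {V : Type*} (G : SimpleGraph V) (u x v : V) : SimpleGraph V :=
  G.deleteEdges {s(u, x)} ⊔ edge v x

section

variable {V : Type*} {G : SimpleGraph V} {u v x a : V}

/-- From a vertex `u` with two neighbours, one neighbour leads towards `v`, and `v` stays reachable
from `u` after deleting the edge to the other one. -/
lemma exists_neighborSet_eq_pair_and_reachable (hG : G.Connected) (huv : u ≠ v)
    (hu : deg G u = 2) :
    ∃ a x, a ≠ x ∧ G.neighborSet u = {a, x} ∧ (G.deleteEdges {s(u, x)}).Reachable u v := by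
  classical
  obtain ⟨p, hp⟩ := hG.exists_isPath u v
  cases p with
  | nil => exact absurd rfl huv
  | @cons _ a _ h q =>
    obtain ⟨-, hq⟩ := (Walk.cons_isPath_iff h q).1 hp
    obtain ⟨c, d, hcd, hN⟩ := Set.ncard_eq_two.1 hu
    have ha : a ∈ G.neighborSet u := h
    obtain ⟨x, hax, hN'⟩ : ∃ x, a ≠ x ∧ G.neighborSet u = {a, x} := by
      rw [hN] at ha ⊢
      rcases ha with rfl | rfl
      · exact ⟨d, hcd, rfl⟩
      · exact ⟨c, hcd.symm, Set.pair_comm _ _⟩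
    refine ⟨a, x, hax, hN', ⟨(Walk.cons h q).toDeleteEdge s(u, x) fun he => ?_⟩⟩
    rw [Walk.edges_cons, List.mem_cons] at he
    rcases he with he | he
    · rcases Sym2.eq_iff.1 he with ⟨-, hxa⟩ | ⟨hua, -⟩
      · exact hax hxa.symm
      · exact h.ne hua
    · exact hq (Walk.fst_mem_support_of_mem_edges q he)

lemma not_reachable_deleteEdges (hG : G.IsTree) (hux : G.Adj u x)
    (hr : (G.deleteEdges {s(u, x)}).Reachable u v) :
    ¬ (G.deleteEdges {s(u, x)}).Reachable v x := fun h =>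
  isBridge_iff.1 (isAcyclic_iff_forall_adj_isBridge.1 hG.isAcyclic hux) (hr.trans h)

lemma ne_of_not_reachable {H : SimpleGraph V} (h : ¬ H.Reachable v x) : v ≠ x := by
  rintro rfl
  exact h (Reachable.refl _)

lemma isTree_moveEdge (hG : G.IsTree) (hux : G.Adj u x)
    (hr : (G.deleteEdges {s(u, x)}).Reachable u v) : (moveEdge G u x v).IsTree := by
  have hvx := not_reachable_deleteEdges hG hux hr
  have hne := ne_of_not_reachable hvx
  refine ⟨?_, (hG.isAcyclic.anti (deleteEdges_le _)).sup_edge_of_not_reachable hvx⟩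
  have hux' : (moveEdge G u x v).Reachable u x :=
    (hr.mono le_sup_left).trans (Adj.reachable (Or.inr ((edge_adj ..).2 ⟨.inl ⟨rfl, rfl⟩, hne⟩)))
  have hadj : ∀ p q, G.Adj p q → (moveEdge G u x v).Reachable p q := by
    intro p q hpq
    by_cases he : s(p, q) = s(u, x)
    · rcases Sym2.eq_iff.1 he with ⟨rfl, rfl⟩ | ⟨rfl, rfl⟩
      · exact hux'
      · exact hux'.symm
    · exact Adj.reachable (Or.inl (deleteEdges_adj.2 ⟨hpq, he⟩))
  have : Nonempty V := ⟨u⟩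
  refine ⟨fun p q => ?_⟩
  obtain ⟨w⟩ := hG.connected.preconnected p q
  induction w with
  | nil => exact Reachable.refl _
  | cons h _ ih => exact (hadj _ _ h).trans ih

lemma not_adj_of_not_reachable_deleteEdges (huv : u ≠ v)
    (hvx : ¬ (G.deleteEdges {s(u, x)}).Reachable v x) : ¬ G.Adj v x := fun h =>
  hvx (Adj.reachable (deleteEdges_adj.2 ⟨h, fun he => by
    rcases Sym2.eq_iff.1 he with ⟨rfl, -⟩ | ⟨rfl, rfl⟩
    · exact huv rfl
    · exact h.ne rfl⟩))

lemma moveEdge_adj {p q : V} (hne : v ≠ x) : (moveEdge G u x v).Adj p q ↔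
    (G.Adj p q ∧ s(p, q) ≠ s(u, x)) ∨ s(p, q) = s(v, x) := by
  simp only [moveEdge, sup_adj, deleteEdges_adj, edge_adj, Set.mem_singleton_iff, Sym2.eq_iff]
  grind

lemma deg_moveEdge_left (hN : G.neighborSet u = {a, x}) (hax : a ≠ x) (huv : u ≠ v)
    (hvx : v ≠ x) : deg (moveEdge G u x v) u = 1 := by
  rw [deg, Set.ncard_eq_one]
  refine ⟨a, ?_⟩
  ext w
  have hw : G.Adj u w ↔ w = a ∨ w = x := by
    rw [← mem_neighborSet, hN]; rfl
  have hxu : G.Adj u x := by rw [← mem_neighborSet, hN]; exact .inr rfl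
  have := hxu.ne
  simp only [mem_neighborSet, moveEdge_adj hvx, Set.mem_singleton_iff, hw, ne_eq, Sym2.eq_iff]
  grind

lemma deg_moveEdge_right [Finite V] (huv : u ≠ v) (hvx : v ≠ x) (hnadj : ¬ G.Adj v x) :
    deg (moveEdge G u x v) v = deg G v + 1 := by
  rw [deg, deg, ← Set.ncard_insert_of_notMem (s := G.neighborSet v) hnadj (Set.toFinite _)]
  congr 1
  ext w
  simp only [mem_neighborSet, moveEdge_adj hvx, Set.mem_insert_iff, ne_eq, Sym2.eq_iff]
  grind

lemma deg_moveEdge_pivot [Finite V] (hux : G.Adj u x) (hvx : v ≠ x)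
    (hnadj : ¬ G.Adj v x) : deg (moveEdge G u x v) x = deg G x := by
  have hu : u ∈ G.neighborSet x := hux.symm
  have hv : v ∉ G.neighborSet x \ {u} := fun h => hnadj (G.adj_symm h.1)
  rw [deg, deg, ← Set.ncard_sdiff_singleton_add_one hu, ← Set.ncard_insert_of_notMem hv]
  congr 1
  ext w
  simp only [mem_neighborSet, moveEdge_adj hvx, Set.mem_insert_iff, ne_eq, Sym2.eq_iff,
    Set.mem_sdiff, Set.mem_singleton_iff]
  grind

lemma deg_moveEdge_of_ne {w : V} (hvx : v ≠ x) (hwu : w ≠ u) (hwv : w ≠ v) (hwx : w ≠ x) :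
    deg (moveEdge G u x v) w = deg G w := by
  rw [deg, deg]
  congr 1
  ext y
  simp only [mem_neighborSet, moveEdge_adj hvx, ne_eq, Sym2.eq_iff]
  grind

lemma edgeSet_moveEdge (hvx : v ≠ x) :
    (moveEdge G u x v).edgeSet = insert s(v, x) (G.edgeSet \ {s(u, x)}) := by
  ext e
  induction e with | h p q =>
  simp only [mem_edgeSet, moveEdge_adj hvx, Set.mem_insert_iff, Set.mem_sdiff,
    Set.mem_singleton_iff, ne_eq]
  tauto

/-- The summand of `M2` belonging to an edge. -/
noncomputable def edgeWeight (G : SimpleGraph V) (e : Sym2 V) : ℕ :=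
  Sym2.lift ⟨fun u w => deg G u * deg G w, fun _ _ => Nat.mul_comm _ _⟩ e

@[simp] lemma edgeWeight_mk (p q : V) : edgeWeight G s(p, q) = deg G p * deg G q := rfl

lemma one_le_deg_of_adj [Finite V] {p q : V} (h : G.Adj p q) : 1 ≤ deg G p :=
  (Set.ncard_pos (Set.toFinite _)).2 ⟨q, h⟩

lemma ncard_incidence [Finite V] (w : V) : {e ∈ G.edgeSet | w ∈ e}.ncard = deg G w := by
  classical
  exact Nat.card_congr (G.incidenceSetEquivNeighborSet w)

end

/-- The comparison of edge weights for a graph `G'` whose degrees differ from those of `G` by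
`2 ↦ 1` at `u` and `3 ↦ 4` at `v`, where `ua` is the only edge at `u` under consideration. -/
lemma edgeWeight_comparison {V : Type*} [Finite V] [DecidableEq V] {G G' : SimpleGraph V}
    {u v a p q : V} (h4 : ∀ w, deg G w ≤ 4) (huv : u ≠ v) (hu : deg G u = 2) (hv : deg G v = 3)
    (hu' : deg G' u = 1) (hv' : deg G' v = 4)
    (hw : ∀ w, w ≠ u → w ≠ v → deg G' w = deg G w) (hpq : G.Adj p q)
    (hupq : u ∈ s(p, q) → s(p, q) = s(u, a)) :
    edgeWeight G s(p, q) + (if v ∈ s(p, q) then 1 else 0) ≤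
      edgeWeight G' s(p, q) + if s(p, q) = s(u, a) then 4 else 0 := by
  have hp1 := one_le_deg_of_adj hpq
  have hq1 := one_le_deg_of_adj hpq.symm
  have hp4 := h4 p
  have hq4 := h4 q
  have hne := hpq.ne
  simp only [edgeWeight_mk]
  by_cases hup : p = u
  · subst hup
    rw [if_pos (hupq (Sym2.mem_mk_left _ _)), hu, hu']
    by_cases hqv : q = v
    · subst hqv; rw [hv, hv']; split_ifs <;> omega
    · rw [hw q hne.symm hqv, if_neg (by simp [Sym2.mem_iff, huv.symm, Ne.symm hqv])]; omega
  by_cases huq : q = u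
  · subst huq
    rw [if_pos (hupq (Sym2.mem_mk_right _ _)), hu, hu']
    by_cases hpv : p = v
    · subst hpv; rw [hv, hv']; split_ifs <;> omega
    · rw [hw p hne hpv, if_neg (by simp [Sym2.mem_iff, huv.symm, Ne.symm hpv])]; omega
  by_cases hpv : p = v
  · subst hpv
    rw [hv, hv', hw q huq hne.symm]; split_ifs <;> omega
  by_cases hqv : q = v
  · subst hqv
    rw [hv, hv', hw p hup hne]; split_ifs <;> omega
  rw [hw p hup hpv, hw q huq hqv, if_neg (by simp [Sym2.mem_iff, Ne.symm hpv, Ne.symm hqv])]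
  omega

section

variable {V : Type*} [Fintype V] {G : SimpleGraph V} {u v x a : V}

lemma M2_lt_M2_moveEdge (h4 : ∀ w, deg G w ≤ 4) (huv : u ≠ v) (hN : G.neighborSet u = {a, x})
    (hax : a ≠ x) (hvx : v ≠ x) (hnadj : ¬ G.Adj v x) (hu : deg G u = 2) (hv : deg G v = 3)
    (hu' : deg (moveEdge G u x v) u = 1) (hv' : deg (moveEdge G u x v) v = 4)
    (hw : ∀ w, w ≠ u → w ≠ v → deg (moveEdge G u x v) w = deg G w) :
    M2 G < M2 (moveEdge G u x v) := by
  classical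
  set G' := moveEdge G u x v with hG'
  have hux : G.Adj u x := by rw [← mem_neighborSet, hN]; exact .inr rfl
  have hua : G.Adj u a := by rw [← mem_neighborSet, hN]; exact .inl rfl
  let E := (Set.toFinite (G.edgeSet \ {s(u, x)})).toFinset
  have hE : (Set.toFinite G.edgeSet).toFinset = insert s(u, x) E := by
    ext e
    by_cases he : e = s(u, x) <;> simp [E, he, hux]
  have hE' : (Set.toFinite G'.edgeSet).toFinset = insert s(v, x) E := by
    ext e
    simp [E, hG', edgeSet_moveEdge hvx]
  have h1 : M2 G = 2 * deg G x + ∑ e ∈ E, edgeWeight G e := by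
    change ∑ e ∈ (Set.toFinite G.edgeSet).toFinset, edgeWeight G e = _
    rw [hE, Finset.sum_insert (by simp [E]), edgeWeight_mk, hu]
  have h2 : M2 G' = 4 * deg G x + ∑ e ∈ E, edgeWeight G' e := by
    change ∑ e ∈ (Set.toFinite G'.edgeSet).toFinset, edgeWeight G' e = _
    rw [hE', Finset.sum_insert (by simp [E, hnadj]), edgeWeight_mk, hv', hw x hux.ne.symm hvx.symm]
  have h3 : ∑ e ∈ E, (edgeWeight G e + if v ∈ e then 1 else 0) ≤
      ∑ e ∈ E, (edgeWeight G' e + if e = s(u, a) then 4 else 0) := by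
    refine Finset.sum_le_sum fun e he => ?_
    induction e with | h p q =>
    have he' : G.Adj p q ∧ s(p, q) ≠ s(u, x) := by simpa [E] using he
    refine edgeWeight_comparison h4 huv hu hv hu' hv' hw he'.1 fun hmem => ?_
    have key : ∀ w, G.Adj u w → w = a ∨ w = x := fun w h => by
      rw [← mem_neighborSet, hN] at h; exact h
    rcases Sym2.mem_iff.1 hmem with rfl | rfl
    · rcases key q he'.1 with rfl | rfl
      · rfl
      · exact absurd rfl he'.2
    · rcases key p he'.1.symm with rfl | rfl
      · exact Sym2.eq_swap
      · exact absurd Sym2.eq_swap he'.2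
  have h5 : (E.filter (v ∈ ·)).card = 3 := by
    rw [← hv, ← ncard_incidence v, ← Set.ncard_coe_finset]
    congr 1
    ext e
    have : v ∈ e → e ≠ s(u, x) := by
      rintro h rfl
      rcases Sym2.mem_iff.1 h with rfl | rfl
      · exact huv rfl
      · exact hvx rfl
    simp only [E, Finset.coe_filter, Set.Finite.mem_toFinset, Set.mem_sdiff,
      Set.mem_singleton_iff, Set.mem_ofPred_eq]
    tauto
  have haE : s(u, a) ∈ E := by
    simpa [E, hua, Sym2.eq_iff, hax] using fun h => absurd h hux.ne
  rw [Finset.sum_add_distrib, Finset.sum_add_distrib, Finset.sum_ite_eq' E, if_pos haE,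
    ← Finset.card_filter, h5] at h3
  have := one_le_deg_of_adj hux.symm
  omega

lemma M1_lt_M1_of_deg {G' : SimpleGraph V} (huv : u ≠ v) (hu : deg G u = 2) (hv : deg G v = 3)
    (hu' : deg G' u = 1) (hv' : deg G' v = 4)
    (hw : ∀ w, w ≠ u → w ≠ v → deg G' w = deg G w) : M1 G < M1 G' := by
  classical
  have key : ∀ H : SimpleGraph V, M1 H =
      deg H u ^ 2 + (deg H v ^ 2 + ∑ w ∈ (Finset.univ.erase u).erase v, deg H w ^ 2) := fun H => by
    rw [Finset.add_sum_erase _ (fun w => deg H w ^ 2) (by simp [huv.symm]),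
      Finset.add_sum_erase _ (fun w => deg H w ^ 2) (Finset.mem_univ u), M1]
  have hs : ∑ w ∈ (Finset.univ.erase u).erase v, deg G' w ^ 2 =
      ∑ w ∈ (Finset.univ.erase u).erase v, deg G w ^ 2 :=
    Finset.sum_congr rfl fun w h => by
      simp only [Finset.mem_erase, Finset.mem_univ, and_true] at h
      rw [hw w h.2 h.1]
  rw [key G, key G', hs, hu, hv, hu', hv']
  omega

/-- A chemical tree with vertices of degree `2` and `3` can be changed into one with the same
number of branching vertices and strictly larger Zagreb indices. -/
lemma exists_isChemicalTree_lt (hG : IsChemicalTree G) (hu : deg G u = 2) (hv : deg G v = 3) :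
    ∃ G' : SimpleGraph V, IsChemicalTree G' ∧ numBranching G' = numBranching G ∧
      M1 G < M1 G' ∧ M2 G < M2 G' := by
  have huv : u ≠ v := by rintro rfl; omega
  obtain ⟨a, x, hax, hN, hr⟩ :=
    exists_neighborSet_eq_pair_and_reachable hG.1.connected huv hu
  have hux : G.Adj u x := by rw [← mem_neighborSet, hN]; exact .inr rfl
  have hvxr := not_reachable_deleteEdges hG.1 hux hr
  have hvx := ne_of_not_reachable hvxr
  have hnadj := not_adj_of_not_reachable_deleteEdges huv hvxr
  have hu' := deg_moveEdge_left hN hax huv hvx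
  have hv' : deg (moveEdge G u x v) v = 4 := by rw [deg_moveEdge_right huv hvx hnadj, hv]
  have hw : ∀ w, w ≠ u → w ≠ v → deg (moveEdge G u x v) w = deg G w := fun w h1 h2 => by
    by_cases hwx : w = x
    · subst hwx; exact deg_moveEdge_pivot hux hvx hnadj
    · exact deg_moveEdge_of_ne hvx h1 h2 hwx
  refine ⟨moveEdge G u x v, ⟨isTree_moveEdge hG.1 hux hr, fun w => ?_⟩, ?_,
    M1_lt_M1_of_deg huv hu hv hu' hv' hw,
    M2_lt_M2_moveEdge hG.2 huv hN hax hvx hnadj hu hv hu' hv' hw⟩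
  · by_cases h1 : w = u
    · subst h1; omega
    by_cases h2 : w = v
    · subst h2; omega
    rw [hw w h1 h2]; exact hG.2 w
  · rw [numBranching, numBranching]
    congr 1
    ext w
    rw [Set.mem_ofPred_eq, Set.mem_ofPred_eq]
    by_cases h1 : w = u
    · subst h1; omega
    by_cases h2 : w = v
    · subst h2; omega
    rw [hw w h1 h2]

end

end ChemTree

open ChemTree

theorem stmt_11 {V : Type*} [Fintype V] (n b : ℕ)
    (hcard : Fintype.card V = n) (hb1 : 1 ≤ b) (hb2 : (b : ℚ) < (n : ℚ) / 2 - 1)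
    (T : SimpleGraph V) (hT : IsChemicalTree T) (hbr : numBranching T = b)
    (hmax : (∀ T' : SimpleGraph V, IsChemicalTree T' → numBranching T' = b →
        M1 T' ≤ M1 T) ∨
      (∀ T' : SimpleGraph V, IsChemicalTree T' → numBranching T' = b →
        M2 T' ≤ M2 T)) :
    ∀ u : V, deg T u = 2 → ∀ v : V, deg T v ≠ 3 := by
  intro u hu v hv
  obtain ⟨T', hT', hbr', h1, h2⟩ := exists_isChemicalTree_lt hT hu hv
  rcases hmax with h | h
  · exact absurd (h T' hT' (hbr'.trans hbr)) (by omega)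
  · exact absurd (h T' hT' (hbr'.trans hbr)) (by omega)
end

section
/- Let 1 ≤ b < n/2 − 1 and let T be an n-vertex chemical tree with exactly b branching vertices such that M2(T') ≤ M2(T) for every n-vertex chemical tree T' with exactly b branching vertices. If T contains a pendent vertex adjacent to a vertex of degree 4, then no two vertices of degree 3 in T are adjacent. -/
open SimpleGraph

open ChemTree

namespace ChemTree

variable {V : Type*} {G : SimpleGraph V}

lemma reachable_deleteEdges_or_of_connected (hG : G.Connected) (a b w : V) :
    (G.deleteEdges {s(a, b)}).Reachable w a ∨ (G.deleteEdges {s(a, b)}).Reachable w b := by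
  obtain ⟨p⟩ := hG.preconnected w a
  suffices ∀ {w z : V}, G.Walk w z → z = a → (G.deleteEdges {s(a, b)}).Reachable w a ∨
      (G.deleteEdges {s(a, b)}).Reachable w b from this p rfl
  intro w z p hz
  induction p with
  | nil => subst hz; exact .inl .rfl
  | @cons w w' _ h p ih =>
    by_cases he : s(w, w') = s(a, b)
    · rcases Sym2.eq_iff.mp he with ⟨rfl, -⟩ | ⟨rfl, -⟩
      · exact .inl .rfl
      · exact .inr .rfl
    · have hadj : (G.deleteEdges {s(a, b)}).Adj w w' := by simp [h, he]
      exact (ih hz).imp hadj.reachable.trans hadj.reachable.trans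

/-- Moving one end of an edge of a tree within its component of the complement of the edge
yields a tree. -/
lemma isTree_move_edge (hG : G.IsTree) {a b c : V} (hab : G.Adj a b)
    (hca : (G.deleteEdges {s(a, b)}).Reachable c a) :
    (G.deleteEdges {s(a, b)} ⊔ edge c b).IsTree := by
  have hbridge : ¬ (G.deleteEdges {s(a, b)}).Reachable a b :=
    isBridge_iff.mp (isAcyclic_iff_forall_adj_isBridge.mp hG.isAcyclic hab)
  have hcb : c ≠ b := by
    rintro rfl
    exact hbridge hca.symm
  have := hG.connected.nonempty
  refine ⟨⟨fun p q ↦ ?_⟩, ?_⟩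
  · have key (w : V) : (G.deleteEdges {s(a, b)} ⊔ edge c b).Reachable w b := by
      have hadj : (G.deleteEdges {s(a, b)} ⊔ edge c b).Adj c b := by simp [edge_adj, hcb]
      rcases reachable_deleteEdges_or_of_connected hG.connected a b w with h | h
      · exact ((h.trans hca.symm).mono le_sup_left).trans hadj.reachable
      · exact h.mono le_sup_left
    exact (key p).trans (key q).symm
  · exact (hG.isAcyclic.anti (deleteEdges_le _)).sup_edge_of_not_reachable
      fun h ↦ hbridge (hca.symm.trans h)

/-- Replace the edges `uv` and `xy` by `ux` and `vy`. -/
def twoSwitch (G : SimpleGraph V) (u v x y : V) : SimpleGraph V :=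
  G.deleteEdges {s(u, v), s(x, y)} ⊔ (edge u x ⊔ edge v y)

lemma isTree_twoSwitch_of_leaf (hG : G.IsTree) {u v x y : V} (huv : G.Adj u v)
    (hu : ∀ w, G.Adj u w → w = v) (hxy : G.Adj x y) (hux : u ≠ x) (huy : u ≠ y)
    (hvx : (G.deleteEdges {s(x, y)}).Reachable v x) : (twoSwitch G u v x y).IsTree := by
  have h₁ := isTree_move_edge hG hxy hvx
  have hxv : ((G.deleteEdges {s(x, y)} ⊔ edge v y).deleteEdges {s(v, u)}).Reachable x v := by
    refine (reachable_deleteEdges_or_of_connected h₁.connected v u x).resolve_right ?_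
    rintro h
    obtain ⟨_ | @⟨_, w, _, hadj, -⟩⟩ := h.symm
    · exact hux rfl
    · have := huv.ne
      have := hu w
      simp only [deleteEdges_adj, sup_adj, edge_adj, Set.mem_singleton_iff, Sym2.eq_iff] at hadj
      grind
  have hadj : (G.deleteEdges {s(x, y)} ⊔ edge v y).Adj v u := by
    have := huv.symm
    simp only [deleteEdges_adj, sup_adj, edge_adj,
      Set.mem_singleton_iff, Sym2.eq_iff, not_or]
    grind
  have h₂ := isTree_move_edge h₁ hadj hxv
  convert h₂ using 1
  ext p q
  simp only [twoSwitch, deleteEdges_adj, sup_adj, edge_adj,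
    Set.mem_insert_iff, Set.mem_singleton_iff, Sym2.eq_iff, not_or]
  have := huv.ne
  have := hxy.ne
  grind

lemma edgeSet_twoSwitch {u v x y : V} (hux : u ≠ x) (hvy : v ≠ y) :
    (twoSwitch G u v x y).edgeSet =
      insert s(u, x) (insert s(v, y) (G.edgeSet \ {s(u, v), s(x, y)})) := by
  rw [twoSwitch, edgeSet_sup, edgeSet_sup, edgeSet_edge_of_ne hux, edgeSet_edge_of_ne hvy,
    edgeSet_deleteEdges, Set.union_comm, Set.union_assoc, Set.singleton_union, Set.singleton_union]

lemma deg_twoSwitch [Finite V] {u v x y : V} (huv : G.Adj u v) (hxy : G.Adj x y)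
    (hux : ¬ G.Adj u x) (hvy : ¬ G.Adj v y) (hux' : u ≠ x) (hvy' : v ≠ y) (z : V) :
    deg (twoSwitch G u v x y) z = deg G z := by
  have huv' := huv.ne
  have hxy' := hxy.ne
  have huy : u ≠ y := by rintro rfl; exact hvy huv.symm
  have hvx : v ≠ x := by rintro rfl; exact hux huv
  have key {c d : V} (hc : ¬ G.Adj z c) (hd : G.Adj z d)
      (h : (twoSwitch G u v x y).neighborSet z = insert c (G.neighborSet z \ {d})) :
      deg (twoSwitch G u v x y) z = deg G z := by
    rw [deg, deg, h, Set.ncard_exchange (by simpa using hc) (by simpa using hd)]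
  have hN (w : V) : w ∈ (twoSwitch G u v x y).neighborSet z ↔
      G.Adj z w ∧ s(z, w) ≠ s(u, v) ∧ s(z, w) ≠ s(x, y) ∨
        s(z, w) = s(u, x) ∨ s(z, w) = s(v, y) := by
    simp only [twoSwitch, mem_neighborSet, deleteEdges_adj, sup_adj, edge_adj,
      Set.mem_insert_iff, Set.mem_singleton_iff, Sym2.eq_iff, not_or]
    grind
  have huv_symm := huv.symm
  have hxy_symm := hxy.symm
  by_cases hzu : z = u
  · subst hzu
    refine key hux huv ?_
    ext w
    rw [hN]
    grind [mem_neighborSet]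
  by_cases hzv : z = v
  · subst hzv
    refine key hvy huv.symm ?_
    ext w
    rw [hN]
    grind [mem_neighborSet]
  by_cases hzx : z = x
  · subst hzx
    refine key (fun h ↦ hux h.symm) hxy ?_
    ext w
    rw [hN]
    grind [mem_neighborSet]
  by_cases hzy : z = y
  · subst hzy
    refine key (fun h ↦ hvy h.symm) hxy.symm ?_
    ext w
    rw [hN]
    grind [mem_neighborSet]
  · unfold deg
    congr 1
    ext w
    rw [hN]
    grind [mem_neighborSet]

lemma M2_twoSwitch [Fintype V] {u v x y : V} (huv : G.Adj u v) (hxy : G.Adj x y)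
    (hux : ¬ G.Adj u x) (hvy : ¬ G.Adj v y) (hux' : u ≠ x) (hvy' : v ≠ y) :
    M2 (twoSwitch G u v x y) + (deg G u * deg G v + deg G x * deg G y) =
      M2 G + (deg G u * deg G x + deg G v * deg G y) := by
  classical
  have huy : u ≠ y := by rintro rfl; exact hvy huv.symm
  have hvx : v ≠ x := by rintro rfl; exact hux huv
  set f : Sym2 V → ℕ :=
    Sym2.lift ⟨fun p q => deg G p * deg G q, fun p q => Nat.mul_comm _ _⟩ with hf
  set R : Finset (Sym2 V) := ((Set.toFinite G.edgeSet).toFinset.erase s(u, v)).erase s(x, y)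
    with hR
  have h₁ : M2 G = f s(u, v) + (f s(x, y) + ∑ e ∈ R, f e) := by
    rw [hR, Finset.add_sum_erase, Finset.add_sum_erase]
    · rfl
    · simpa using huv
    · simp only [Finset.mem_erase, Set.Finite.mem_toFinset, mem_edgeSet]
      grind
  have h₂ : M2 (twoSwitch G u v x y) = f s(u, x) + (f s(v, y) + ∑ e ∈ R, f e) := by
    have hE : (Set.toFinite (twoSwitch G u v x y).edgeSet).toFinset =
        insert s(u, x) (insert s(v, y) R) := by
      ext e
      simp only [Set.Finite.mem_toFinset, edgeSet_twoSwitch hux' hvy', hR]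
      grind [Set.Finite.mem_toFinset]
    have hvyR : s(v, y) ∉ R := by simp [hR, hvy]
    have huxR : s(u, x) ∉ insert s(v, y) R := by
      simp only [Finset.mem_insert, hR, Finset.mem_erase, Set.Finite.mem_toFinset, mem_edgeSet]
      have := huv.ne
      grind
    simp only [M2, deg_twoSwitch huv hxy hux hvy hux' hvy']
    rw [hE, Finset.sum_insert huxR, Finset.sum_insert hvyR]
  rw [h₁, h₂]
  simp only [hf, Sym2.lift_mk]
  ring

end ChemTree

theorem stmt_15 {V : Type*} [Fintype V] (n b : ℕ)
    (hcard : Fintype.card V = n) (hb1 : 1 ≤ b) (hb2 : (b : ℚ) < (n : ℚ) / 2 - 1)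
    (T : SimpleGraph V) (hT : IsChemicalTree T) (hbr : numBranching T = b)
    (hmax : ∀ T' : SimpleGraph V, IsChemicalTree T' → numBranching T' = b →
      M2 T' ≤ M2 T)
    (hpend : ∃ u v : V, deg T u = 1 ∧ deg T v = 4 ∧ T.Adj u v) :
    ∀ x y : V, deg T x = 3 → deg T y = 3 → ¬ T.Adj x y := by
  suffices key : ∀ u v x y : V, deg T u = 1 → deg T v = 4 → T.Adj u v → deg T x = 3 →
      deg T y = 3 → T.Adj x y → (T.deleteEdges {s(x, y)}).Reachable v x → False by
    obtain ⟨u, v, hu, hv, huv⟩ := hpend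
    intro x y hx hy hxy
    rcases reachable_deleteEdges_or_of_connected hT.1.connected x y v with h | h
    · exact key u v x y hu hv huv hx hy hxy h
    · rw [Sym2.eq_swap] at h
      exact key u v y x hu hv huv hy hx hxy.symm h
  intro u v x y hu hv huv hx hy hxy hvx
  have hleaf (w : V) (h : T.Adj u w) : w = v := by
    obtain ⟨a, ha⟩ := Set.ncard_eq_one.mp hu
    have hwa : w ∈ ({a} : Set V) := ha ▸ h
    have hva : v ∈ ({a} : Set V) := ha ▸ huv
    exact hwa.trans hva.symm
  have hux' : u ≠ x := by rintro rfl; omega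
  have huy' : u ≠ y := by rintro rfl; omega
  have hvx' : v ≠ x := by rintro rfl; omega
  have hvy' : v ≠ y := by rintro rfl; omega
  have hux : ¬ T.Adj u x := fun h ↦ hvx' (hleaf x h).symm
  have hvy : ¬ T.Adj v y := by
    intro h
    refine isBridge_iff.mp (isAcyclic_iff_forall_adj_isBridge.mp hT.1.isAcyclic hxy)
      (hvx.symm.trans (Adj.reachable ?_))
    simp only [deleteEdges_adj]
    grind
  have hdeg := deg_twoSwitch huv hxy hux hvy hux' hvy'
  have hle := hmax (twoSwitch T u v x y)
    ⟨isTree_twoSwitch_of_leaf hT.1 huv hleaf hxy hux' huy' hvx, fun z ↦ hdeg z ▸ hT.2 z⟩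
    (by simpa only [numBranching, hdeg] using hbr)
  have hM := M2_twoSwitch huv hxy hux hvy hux' hvy'
  rw [hu, hv, hx, hy] at hM
  omega
end
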